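/- arXiv:math/0210040 — 2 statements merged into one kernel-verified Lean document; each statement's English description precedes it below -/
import Mathlib

section
/- Let p ≥ 0 be an integer, κ = 2p+3, and j ∈ {0,1}. Define η(τ)^c for real c by η(τ)^c = exp(c·(πiτ/12 + Σ_{k=1}^∞ Log(1 − e^{2πikτ}))), where Log is the principal logarithm (each factor 1 − e^{2πikτ} lies in the disc of radius 1 around 1, so this is well defined and holomorphic in τ). Then the function v(λ,τ) = η(τ)^{−3(p+1)/κ} · ϑ₁(λ,τ)^{p+1} · θ_{1,j}(λ,τ) satisfies the KZB heat equation with parameters κ and p, namely 2πiκ ∂v/∂τ(λ,τ) = ∂²v/∂λ²(λ,τ) + p(p+1)ρ′(λ,τ)v(λ,τ), at every (λ,τ) ∈ ℂ×ℍ with ϑ₁(λ,τ) ≠ 0. -/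
open Complex

/-- The complex number π. -/
noncomputable def cπ : ℂ := Real.pi

/-- The first Jacobi theta function
`ϑ₁(λ,τ) = 2 q^{1/8} sin(πλ) ∏_{j≥1} (1-q^j e^{2πiλ})(1-q^j e^{-2πiλ})(1-q^j)`, `q = e^{2πiτ}`. -/
noncomputable def JTheta1 (z τ : ℂ) : ℂ :=
  2 * exp (cπ * I * τ / 4) * sin (cπ * z) *
    ∏' n : ℕ, ((1 - exp (2 * cπ * I * τ) ^ (n + 1) * exp (2 * cπ * I * z)) *
      (1 - exp (2 * cπ * I * τ) ^ (n + 1) * exp (-(2 * cπ * I * z))) *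
      (1 - exp (2 * cπ * I * τ) ^ (n + 1)))

/-- The Dedekind eta function `η(τ) = q^{1/24} ∏_{j≥1} (1-q^j)`, `q = e^{2πiτ}`. -/
noncomputable def DEta (τ : ℂ) : ℂ :=
  exp (cπ * I * τ / 12) * ∏' n : ℕ, (1 - exp (2 * cπ * I * τ) ^ (n + 1))

/-- The theta function of level κ:
`θ_{κ,n}(λ,τ) = Σ_{j∈ℤ} exp(2πiκ(j+n/(2κ))²τ + 2πiκ(j+n/(2κ))λ)`. -/
noncomputable def ThetaKN (κ : ℕ) (n : ℤ) (z τ : ℂ) : ℂ :=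
  ∑' j : ℤ, exp (2 * cπ * I * (κ : ℂ) * ((j : ℂ) + (n : ℂ) / (2 * (κ : ℂ))) ^ 2 * τ +
    2 * cπ * I * (κ : ℂ) * ((j : ℂ) + (n : ℂ) / (2 * (κ : ℂ))) * z)

/-- The symmetrization `θ^s_{κ,n}(λ,τ) = θ_{κ,n}(λ,τ) + θ_{κ,n}(-λ,τ)`. -/
noncomputable def ThetaS (κ : ℕ) (n : ℤ) (z τ : ℂ) : ℂ :=
  ThetaKN κ n z τ + ThetaKN κ n (-z) τ

/-- `ρ(λ,τ) = ϑ₁'(λ,τ)/ϑ₁(λ,τ)` (derivative in the first argument). -/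
noncomputable def Rho (z τ : ℂ) : ℂ :=
  deriv (fun w => JTheta1 w τ) z / JTheta1 z τ

/-- `ρ'(λ,τ)`, the derivative of `ρ` in the first argument. -/
noncomputable def Rho' (z τ : ℂ) : ℂ := deriv (fun w => Rho w τ) z

/-- `u` satisfies the KZB heat equation with parameters `κ`, `p` at `(λ,τ)`:
`2πiκ ∂u/∂τ = ∂²u/∂λ² + p(p+1)ρ'(λ,τ)u`. -/
def KZB (κ p : ℕ) (u : ℂ → ℂ → ℂ) (z τ : ℂ) : Prop :=
  2 * cπ * I * (κ : ℂ) * deriv (fun t => u z t) τ =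
    iteratedDeriv 2 (fun w => u w τ) z + (p : ℂ) * ((p : ℂ) + 1) * Rho' z τ * u z τ

/-- The power `η(τ)^c` for real `c`, defined as
`exp(c(πiτ/12 + Σ_{k≥1} Log(1 - e^{2πikτ})))` with the principal logarithm. -/
noncomputable def EtaPow (c : ℝ) (τ : ℂ) : ℂ :=
  exp ((c : ℂ) * (cπ * I * τ / 12 +
    ∑' k : ℕ, Complex.log (1 - exp (2 * cπ * I * τ) ^ (k + 1))))


/-! ### Jacobi triple product -/

/-- Finite q-Pochhammer symbol. -/
noncomputable def qPo (q : ℂ) (n : ℕ) : ℂ := ∏ i ∈ Finset.range n, (1 - q ^ (i + 1))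

/-- Inverse of the q-Pochhammer symbol, extended by zero to negative integers. -/
noncomputable def qR (q : ℂ) (m : ℤ) : ℂ := if 0 ≤ m then (qPo q m.toNat)⁻¹ else 0

lemma one_sub_qpow_ne {q : ℂ} (hq : ‖q‖ < 1) (i : ℕ) : 1 - q ^ (i + 1) ≠ 0 := by
  intro h
  have h1 : q ^ (i + 1) = 1 := (sub_eq_zero.mp h).symm
  have h2 : ‖q‖ ^ (i + 1) < 1 := pow_lt_one₀ (norm_nonneg _) hq (by omega)
  rw [← norm_pow, h1] at h2
  simp at h2

lemma qPo_ne {q : ℂ} (hq : ‖q‖ < 1) (n : ℕ) : qPo q n ≠ 0 :=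
  Finset.prod_ne_zero_iff.mpr fun i _ => one_sub_qpow_ne hq i

lemma qR_rec {q : ℂ} (hq : ‖q‖ < 1) (m : ℤ) : qR q (m - 1) = (1 - q ^ m) * qR q m := by
  rcases lt_trichotomy m 0 with h | h | h
  · have h1 : ¬ (0 ≤ m) := by omega
    have h2 : ¬ (0 ≤ m - 1) := by omega
    rw [qR, qR, if_neg h1, if_neg h2]; simp
  · subst h; simp [qR]
  · obtain ⟨n, rfl⟩ : ∃ n : ℕ, m = n + 1 := ⟨(m - 1).toNat, by omega⟩
    have e1 : ((n : ℤ) + 1 - 1).toNat = n := by omega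
    have e2 : ((n : ℤ) + 1).toNat = n + 1 := by omega
    rw [qR, qR, if_pos (by omega), if_pos (by omega), e1, e2, qPo, qPo, Finset.prod_range_succ]
    have h3 := one_sub_qpow_ne hq n
    have h4 := qPo_ne hq n
    rw [qPo] at h4
    have h5 : q ^ ((n : ℤ) + 1) = q ^ (n + 1) := by exact_mod_cast zpow_natCast q (n + 1)
    rw [h5]
    field_simp

lemma HasSum.congr_fun' {f g : ℤ → ℂ} {a : ℂ} (h : HasSum f a) (hfg : ∀ k, g k = f k) :
    HasSum g a := by
  rwa [show g = f from funext hfg]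

lemma jtp_finite {q x : ℂ} (hq0 : q ≠ 0) (hq : ‖q‖ < 1) (hx : x ≠ 0) {w : ℤ → ℂ}
    (hw0 : w 0 = 1) (hw : ∀ k, w (k + 1) = -(w k * q ^ (k + 1) * x)) (N : ℕ) :
    HasSum (fun k : ℤ => qPo q (2 * N) * qR q (N + k) * qR q (N - k) * w k)
      (∏ n ∈ Finset.range N, ((1 - q ^ (n + 1) * x) * (1 - q ^ n / x))) := by
  induction N with
  | zero =>
    have : (∏ n ∈ Finset.range 0, ((1 - q ^ (n + 1) * x) * (1 - q ^ n / x)))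
        = (fun k : ℤ => qPo q (2 * 0) * qR q ((0 : ℕ) + k) * qR q ((0 : ℕ) - k) * w k) 0 := by
      simp [qPo, qR, hw0]
    rw [this]
    refine hasSum_single _ fun k hk => ?_
    rcases lt_or_gt_of_ne hk with h | h
    · have : qR q ((0 : ℕ) + k) = 0 := by rw [qR, if_neg (by push_cast; omega)]
      simp only [this]; ring
    · have : qR q ((0 : ℕ) - k) = 0 := by rw [qR, if_neg (by push_cast; omega)]
      simp only [this]; ring
  | succ N ih =>
    rw [Finset.prod_range_succ]
    have h1 := ih.mul_left (1 + q ^ (2 * N + 1))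
    have h2 := ((Equiv.subRight (1 : ℤ)).hasSum_iff.mpr ih).mul_left (-(q ^ (N + 1) * x))
    have h3 := ((Equiv.addRight (1 : ℤ)).hasSum_iff.mpr ih).mul_left (-(q ^ N / x))
    have h4 := (h1.add h2).add h3
    have hval : (∏ n ∈ Finset.range N, ((1 - q ^ (n + 1) * x) * (1 - q ^ n / x))) *
        ((1 - q ^ (N + 1) * x) * (1 - q ^ N / x)) = (1 + q ^ (2 * N + 1)) *
        ∏ n ∈ Finset.range N, ((1 - q ^ (n + 1) * x) * (1 - q ^ n / x)) +
        -(q ^ (N + 1) * x) * ∏ n ∈ Finset.range N, ((1 - q ^ (n + 1) * x) * (1 - q ^ n / x)) +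
        -(q ^ N / x) * ∏ n ∈ Finset.range N, ((1 - q ^ (n + 1) * x) * (1 - q ^ n / x)) := by
      generalize (∏ n ∈ Finset.range N, ((1 - q ^ (n + 1) * x) * (1 - q ^ n / x))) = P
      field_simp
      ring
    rw [hval]
    refine h4.congr_fun' (fun k => ?_)
    · simp only [Function.comp, Equiv.subRight_apply, Equiv.coe_addRight]
      have r1 := qR_rec hq ((N : ℤ) + 1 + k)
      have r2 := qR_rec hq ((N : ℤ) + 1 + k - 1)
      have r3 := qR_rec hq ((N : ℤ) + 1 - k)
      have r4 := qR_rec hq ((N : ℤ) + 1 - k - 1)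
      have w1 := hw (k - 1)
      rw [sub_add_cancel] at w1
      have w2 := hw k
      rw [r1] at r2
      rw [r3] at r4
      have e1 : (N : ℤ) + k = N + 1 + k - 1 := by ring
      have e2 : (N : ℤ) - k = N + 1 - k - 1 := by ring
      have e3 : (N : ℤ) + (k - 1) = N + 1 + k - 1 - 1 := by ring
      have e4 : (N : ℤ) - (k - 1) = N + 1 - k := by ring
      have e5 : (N : ℤ) + (k + 1) = N + 1 + k := by ring
      have e6 : (N : ℤ) - (k + 1) = N + 1 - k - 1 - 1 := by ring
      rw [e1, e2, e3, e4, e5, e6, r1, r2, r3, r4]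
      push_cast
      have p1 : qPo q (2 * (N + 1)) = qPo q (2 * N) * (1 - q ^ (2 * N + 1)) * (1 - q ^ (2 * N + 2)) := by
        rw [show 2 * (N + 1) = 2 * N + 1 + 1 by ring, qPo, Finset.prod_range_succ,
          Finset.prod_range_succ, qPo]
      rw [p1]
      generalize qR q ((N : ℤ) + 1 + k) = R
      generalize qR q ((N : ℤ) + 1 - k) = S
      generalize qPo q (2 * N) = T
      have z1 : q ^ ((N : ℤ) + 1 + k) = q ^ N * q * q ^ k := by
        rw [zpow_add₀ hq0, zpow_add₀ hq0]; simp
      have z2 : q ^ ((N : ℤ) + 1 - k) = q ^ N * q * (q ^ k)⁻¹ := by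
        rw [zpow_sub₀ hq0, zpow_add₀ hq0]; simp [div_eq_mul_inv]
      have z3 : q ^ ((N : ℤ) + 1 + k - 1) = q ^ N * q ^ k := by
        rw [zpow_sub₀ hq0, z1, zpow_one]; field_simp
      have z4 : q ^ ((N : ℤ) + 1 - k - 1) = q ^ N * (q ^ k)⁻¹ := by
        rw [zpow_sub₀ hq0, z2, zpow_one]; field_simp
      have hk0 : q ^ k ≠ 0 := zpow_ne_zero _ hq0
      have z5 : q ^ (k + 1) = q ^ k * q := by rw [zpow_add₀ hq0, zpow_one]
      rw [w2, z5]
      have w3 : -(q ^ (N + 1) * x) * w (k - 1) = q ^ N * q * (q ^ k)⁻¹ * w k := by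
        rw [w1]; field_simp; ring
      rw [z1, z2, z3, z4]
      have : -(q ^ (N + 1) * x) * (T * ((1 - q ^ N * q ^ k) * ((1 - q ^ N * q * q ^ k) * R)) * S * w (k - 1))
        = (T * ((1 - q ^ N * q ^ k) * ((1 - q ^ N * q * q ^ k) * R)) * S) * (-(q ^ (N + 1) * x) * w (k - 1)) := by ring
      rw [this, w3]
      have a1 : q ^ (2 * N + 1) = q ^ N * q ^ N * q := by ring
      have a2 : q ^ (2 * N + 2) = q ^ N * q ^ N * q * q := by ring
      rw [a1, a2]
      generalize q ^ N = A at *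
      generalize q ^ k = B at *
      field_simp
      ring

lemma qPo_tendsto {q : ℂ} (hq : ‖q‖ < 1) :
    Filter.Tendsto (qPo q) Filter.atTop (nhds (∏' n : ℕ, (1 - q ^ (n + 1)))) :=
  (ModularForm.multipliable_one_sub_pow hq).hasProd.tendsto_prod_nat

lemma qInf_ne {q : ℂ} (hq : ‖q‖ < 1) : ∏' n : ℕ, (1 - q ^ (n + 1)) ≠ 0 := by
  refine tprod_one_add_ne_zero_of_summable (f := fun n : ℕ => -q ^ (n + 1)) ?_ ?_
  · exact fun i ↦ by simpa [← sub_eq_add_neg] using one_sub_qpow_ne hq i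
  · simpa using (summable_nat_add_iff 1).mpr (summable_geometric_of_lt_one (norm_nonneg _) hq)

lemma qR_tendsto {q : ℂ} (hq : ‖q‖ < 1) (s : ℕ → ℤ)
    (hs : Filter.Tendsto (fun n => (s n).toNat) Filter.atTop Filter.atTop)
    (hs' : ∀ᶠ n in Filter.atTop, 0 ≤ s n) :
    Filter.Tendsto (fun n => qR q (s n)) Filter.atTop (nhds (∏' n : ℕ, (1 - q ^ (n + 1)))⁻¹) := by
  have h := ((qPo_tendsto hq).comp hs).inv₀ (qInf_ne hq)
  refine h.congr' ?_
  filter_upwards [hs'] with n hn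
  simp [qR, hn]

lemma qR_bdd {q : ℂ} (hq : ‖q‖ < 1) : ∃ C, ∀ m, ‖qR q m‖ ≤ C := by
  have h := ((qPo_tendsto hq).inv₀ (qInf_ne hq)).norm.bddAbove_range
  obtain ⟨C, hC⟩ := h
  refine ⟨max C 0, fun m => ?_⟩
  rw [qR]
  split_ifs
  · exact le_max_of_le_left (hC ⟨m.toNat, rfl⟩)
  · simp

lemma jtp {q x : ℂ} (hq0 : q ≠ 0) (hq : ‖q‖ < 1) (hx : x ≠ 0) {w : ℤ → ℂ}
    (hw0 : w 0 = 1) (hw : ∀ k, w (k + 1) = -(w k * q ^ (k + 1) * x))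
    (hws : Summable fun k => ‖w k‖) :
    Filter.Tendsto (fun N => qPo q N *
      ∏ n ∈ Finset.range N, ((1 - q ^ (n + 1) * x) * (1 - q ^ n / x))) Filter.atTop
      (nhds (∑' k, w k)) := by
  obtain ⟨C, hC⟩ := qR_bdd hq
  obtain ⟨D, hD⟩ := (qPo_tendsto hq).norm.bddAbove_range
  have hC0 : 0 ≤ C := (norm_nonneg _).trans (hC 0)
  have hD0 : 0 ≤ D := (norm_nonneg _).trans (hD ⟨0, rfl⟩)
  have key : Filter.Tendsto (fun N : ℕ => ∑' k : ℤ, qPo q (2 * N) * qR q (N + k) * qR q (N - k) * w k)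
      Filter.atTop (nhds (∑' k, (∏' n : ℕ, (1 - q ^ (n + 1)))⁻¹ * w k)) := by
    refine tendsto_tsum_of_dominated_convergence (hws.mul_left (D * C * C)) (fun k => ?_)
      (Filter.Eventually.of_forall fun N k => ?_)
    · have t1 : Filter.Tendsto (fun N : ℕ => qPo q (2 * N)) Filter.atTop
          (nhds (∏' n : ℕ, (1 - q ^ (n + 1)))) :=
        (qPo_tendsto hq).comp (Filter.tendsto_atTop_mono (fun n => by simp only [id]; omega) Filter.tendsto_id)
      have t2 := qR_tendsto hq (fun N : ℕ => (N : ℤ) + k)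
        (Filter.tendsto_atTop.mpr fun b => by
          filter_upwards [Filter.eventually_ge_atTop (b + k.natAbs)] with n hn; omega)
        (by filter_upwards [Filter.eventually_ge_atTop (k.natAbs)] with n hn; omega)
      have t3 := qR_tendsto hq (fun N : ℕ => (N : ℤ) - k)
        (Filter.tendsto_atTop.mpr fun b => by
          filter_upwards [Filter.eventually_ge_atTop (b + k.natAbs)] with n hn; omega)
        (by filter_upwards [Filter.eventually_ge_atTop (k.natAbs)] with n hn; omega)
      have t := ((t1.mul t2).mul t3).mul_const (w k)
      rw [mul_inv_cancel₀ (qInf_ne hq), one_mul] at t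
      exact t
    · rw [norm_mul, norm_mul, norm_mul]
      have := hD ⟨2 * N, rfl⟩
      simp only at this
      gcongr
      · exact hC _
      · exact hC _
  rw [tsum_mul_left] at key
  have := (qPo_tendsto hq).mul key
  rw [mul_inv_cancel_left₀ (qInf_ne hq)] at this
  refine this.congr fun N => ?_
  rw [(jtp_finite hq0 hq hx hw0 hw N).tsum_eq]


/-! ### Theta series and the heat equation -/

lemma hasDerivAt_jt'_fst (z : ℂ) {τ : ℂ} (hτ : 0 < τ.im) :
    HasDerivAt (jacobiTheta₂' · τ) (4 * cπ * I * jacobiTheta₂_fderiv z τ (0, 1)) z := by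
  let ev : (ℂ × ℂ →L[ℂ] ℂ) →L[ℂ] ℂ :=
  { toFun := fun f ↦ f (0, 1)
    map_add' := by simp
    map_smul' := by simp }
  have step1 : HasSum (fun n ↦ (jacobiTheta₂_term_fderiv n z τ) (0, 1))
      ((jacobiTheta₂_fderiv z τ) (0, 1)) := by
    apply ev.hasSum (hasSum_jacobiTheta₂_term_fderiv z hτ)
  have step2 := step1.mul_left (4 * cπ * I)
  obtain ⟨S, hz⟩ := exists_gt |im z|
  let V : Set ℂ := {u | |im u| < S}
  have hVo : IsOpen V := (_root_.continuous_abs.comp continuous_im).isOpen_preimage _ isOpen_Iio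
  let u : ℤ → ℝ := fun n => 2 * Real.pi * |n| * Real.exp (-Real.pi * (τ.im * n ^ 2 - 2 * S * |n|))
  have hu : Summable u := by
    have := (summable_pow_mul_jacobiTheta₂_term_bound S hτ 1).mul_left (2 * Real.pi)
    simp only [pow_one, ← mul_assoc] at this
    simpa only [u, Int.cast_abs] using this
  have hd : ∀ n : ℤ, ∀ w, HasDerivAt (fun w => jacobiTheta₂'_term n w τ)
      (4 * cπ * I * (jacobiTheta₂_term_fderiv n w τ) (0, 1)) w := by
    intro n w
    have h1 : HasDerivAt (fun w => jacobiTheta₂'_term n w τ)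
      (2 * Real.pi * I * n * (cexp (2 * Real.pi * I * n * w + Real.pi * I * n ^ 2 * τ) * (2 * Real.pi * I * n))) w := by
      have h0 : HasDerivAt (fun w : ℂ => 2 * Real.pi * I * n * w + Real.pi * I * n ^ 2 * τ)
        (2 * Real.pi * I * n) w := by
        simpa using ((hasDerivAt_id w).const_mul (2 * Real.pi * I * n : ℂ)).add_const (Real.pi * I * n ^ 2 * τ)
      exact h0.cexp.const_mul _
    convert h1 using 1
    simp [jacobiTheta₂_term_fderiv, cπ]
    ring
  have hf : ∀ n : ℤ, DifferentiableOn ℂ (fun w => jacobiTheta₂'_term n w τ) V :=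
    fun n w _ => (hd n w).differentiableAt.differentiableWithinAt
  have hb : ∀ (n : ℤ) (w : ℂ), w ∈ V → ‖jacobiTheta₂'_term n w τ‖ ≤ u n :=
    fun n w hw => norm_jacobiTheta₂'_term_le hτ (le_of_lt hw) le_rfl n
  have h3 := hasSum_deriv_of_summable_norm hu hf hVo hb hz
  have h4 := (differentiableOn_tsum_of_summable_norm hu hf hVo hb).differentiableAt (hVo.mem_nhds hz)
  have h5 := h4.hasDerivAt
  have h6 := h3.congr_fun' (g := fun n => 4 * cπ * I * (jacobiTheta₂_term_fderiv n z τ) (0, 1))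
    (fun n => (hd n z).deriv.symm)
  rw [← step2.unique h6] at h5
  exact h5

/-- Heat equation `∂²f/∂z² = α ∂f/∂τ` on `ℂ × ℍ`. -/
def Heat (α : ℂ) (f : ℂ → ℂ → ℂ) : Prop :=
  ∃ D1 D2 Dt : ℂ → ℂ → ℂ, ∀ z τ : ℂ, 0 < τ.im →
    HasDerivAt (fun w => f w τ) (D1 z τ) z ∧ HasDerivAt (fun w => D1 w τ) (D2 z τ) z ∧
    HasDerivAt (fun t => f z t) (Dt z τ) τ ∧ D2 z τ = α * Dt z τ

lemma Heat.const_mul {α : ℂ} {f : ℂ → ℂ → ℂ} (h : Heat α f) (a : ℂ) :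
    Heat α (fun z τ => a * f z τ) := by
  obtain ⟨D1, D2, Dt, h⟩ := h
  refine ⟨fun z τ => a * D1 z τ, fun z τ => a * D2 z τ, fun z τ => a * Dt z τ, fun z τ hτ => ?_⟩
  obtain ⟨h1, h2, h3, h4⟩ := h z τ hτ
  exact ⟨h1.const_mul a, h2.const_mul a, h3.const_mul a, by simp only [h4]; ring⟩

lemma Heat.sub {α : ℂ} {f g : ℂ → ℂ → ℂ} (h : Heat α f) (h' : Heat α g) :
    Heat α (fun z τ => f z τ - g z τ) := by
  obtain ⟨D1, D2, Dt, h⟩ := h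
  obtain ⟨E1, E2, Et, h'⟩ := h'
  refine ⟨fun z τ => D1 z τ - E1 z τ, fun z τ => D2 z τ - E2 z τ,
    fun z τ => Dt z τ - Et z τ, fun z τ hτ => ?_⟩
  obtain ⟨h1, h2, h3, h4⟩ := h z τ hτ
  obtain ⟨g1, g2, g3, g4⟩ := h' z τ hτ
  exact ⟨h1.sub g1, h2.sub g2, h3.sub g3, by simp only [h4, g4]; ring⟩

lemma Heat.congr {α : ℂ} {f g : ℂ → ℂ → ℂ} (h : Heat α f)
    (hfg : ∀ z τ : ℂ, 0 < τ.im → g z τ = f z τ) : Heat α g := by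
  obtain ⟨D1, D2, Dt, h⟩ := h
  refine ⟨D1, D2, Dt, fun z τ hτ => ?_⟩
  obtain ⟨h1, h2, h3, h4⟩ := h z τ hτ
  refine ⟨?_, h2, ?_, h4⟩
  · rwa [show (fun w => g w τ) = fun w => f w τ from funext fun w => hfg w τ hτ]
  · refine h3.congr_of_eventuallyEq ?_
    filter_upwards [(isOpen_lt continuous_const continuous_im).mem_nhds hτ] with t ht
    exact hfg z t ht

/-- General theta term. -/
noncomputable def thT (s c d y z τ : ℂ) (k : ℤ) : ℂ :=
  exp (cπ * I * s * k + 2 * cπ * I * (c * (k + y) ^ 2 * τ + d * (k + y) * z))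

/-- General theta series. -/
noncomputable def Th (s c d y z τ : ℂ) : ℂ := ∑' k : ℤ, thT s c d y z τ k

lemma thT_eq (s c d y z τ : ℂ) (k : ℤ) : thT s c d y z τ k =
    exp (2 * cπ * I * (c * y ^ 2 * τ + d * y * z)) *
      jacobiTheta₂_term k (s / 2 + 2 * c * y * τ + d * z) (2 * c * τ) := by
  rw [thT, jacobiTheta₂_term, ← exp_add]
  congr 1
  simp only [cπ]
  ring

lemma Th_eq (s c d y z τ : ℂ) : Th s c d y z τ =
    exp (2 * cπ * I * (c * y ^ 2 * τ + d * y * z)) *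
      jacobiTheta₂ (s / 2 + 2 * c * y * τ + d * z) (2 * c * τ) := by
  simp only [Th, thT_eq, tsum_mul_left, jacobiTheta₂]

lemma thT_summable {s c d y z τ : ℂ} (h : 0 < (2 * c * τ).im) :
    Summable fun k => ‖thT s c d y z τ k‖ := by
  simp only [thT_eq, norm_mul]
  exact (((summable_jacobiTheta₂_term_iff _ _).mpr h).norm).mul_left _

lemma fderiv_10 (z : ℂ) {τ : ℂ} (hτ : 0 < τ.im) :
    jacobiTheta₂_fderiv z τ (1, 0) = jacobiTheta₂' z τ := by
  have step3 : HasDerivAt (fun x ↦ jacobiTheta₂ x τ) ((jacobiTheta₂_fderiv z τ) (1, 0)) z :=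
    (((hasFDerivAt_jacobiTheta₂ z hτ).comp z (hasFDerivAt_prodMk_left z τ)).hasDerivAt :)
  exact step3.unique (hasDerivAt_jacobiTheta₂_fst z hτ)

lemma Th_heat {s c d y : ℂ} (hc0 : c ≠ 0) (hc : ∀ τ : ℂ, 0 < τ.im → 0 < (2 * c * τ).im) :
    Heat (2 * cπ * I * d ^ 2 / c) (Th s c d y) := by
  let E : ℂ → ℂ → ℂ := fun z τ => exp (2 * cπ * I * (c * y ^ 2 * τ + d * y * z))
  let B : ℂ → ℂ → ℂ := fun z τ => s / 2 + 2 * c * y * τ + d * z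
  let u : ℂ := 2 * cπ * I
  let j0 : ℂ → ℂ → ℂ := fun z τ => jacobiTheta₂ (B z τ) (2 * c * τ)
  let j1 : ℂ → ℂ → ℂ := fun z τ => jacobiTheta₂' (B z τ) (2 * c * τ)
  let jt : ℂ → ℂ → ℂ := fun z τ => jacobiTheta₂_fderiv (B z τ) (2 * c * τ) (0, 1)
  refine ⟨fun z τ => (E z τ * (u * (d * y))) * j0 z τ + E z τ * (j1 z τ * d),
    fun z τ => ((E z τ * (u * (d * y))) * (u * (d * y))) * j0 z τ + (E z τ * (u * (d * y))) * (j1 z τ * d)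
      + ((E z τ * (u * (d * y))) * (j1 z τ * d) + E z τ * ((2 * u * jt z τ * d) * d)),
    fun z τ => (E z τ * (u * (c * y ^ 2))) * j0 z τ + E z τ * (2 * c * y * j1 z τ + 2 * c * jt z τ),
    fun z τ hτ => ?_⟩
  have hτ' := hc τ hτ
  have hE : ∀ z, HasDerivAt (fun w => E w τ) (E z τ * (u * (d * y))) z := by
    intro z
    have h0 : HasDerivAt (fun w : ℂ => 2 * cπ * I * (c * y ^ 2 * τ + d * y * w)) (u * (d * y)) z := by
      simpa using (((hasDerivAt_id z).const_mul (d * y)).const_add (c * y ^ 2 * τ)).const_mul u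
    exact h0.cexp
  have hEt : HasDerivAt (fun t => E z t) (E z τ * (u * (c * y ^ 2))) τ := by
    have h0 : HasDerivAt (fun t : ℂ => 2 * cπ * I * (c * y ^ 2 * t + d * y * z)) (u * (c * y ^ 2)) τ := by
      simpa using (((hasDerivAt_id τ).const_mul (c * y ^ 2)).add_const (d * y * z)).const_mul u
    exact h0.cexp
  have hB : ∀ z, HasDerivAt (fun w => B w τ) d z := by
    intro z
    exact (((hasDerivAt_id z).const_mul d).const_add (s / 2 + 2 * c * y * τ)).congr_deriv (mul_one _)
  have hj0 : ∀ z, HasDerivAt (fun w => j0 w τ) (j1 z τ * d) z := by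
    intro z
    exact (hasDerivAt_jacobiTheta₂_fst (B z τ) hτ').comp z (hB z)
  have hj1 : HasDerivAt (fun w => j1 w τ) (2 * u * jt z τ * d) z := by
    have := (hasDerivAt_jt'_fst (B z τ) hτ').comp z (hB z)
    refine this.congr_deriv ?_
    simp only [u, jt]; ring
  have hjt : HasDerivAt (fun t => j0 z t) (2 * c * y * j1 z τ + 2 * c * jt z τ) τ := by
    have hBt : HasDerivAt (fun t => B z t) (2 * c * y) τ := by
      exact ((((hasDerivAt_id τ).const_mul (2 * c * y)).const_add (s / 2)).add_const
        (d * z)).congr_deriv (mul_one _)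
    have hCt : HasDerivAt (fun t : ℂ => 2 * c * t) (2 * c) τ := by
      simpa using (hasDerivAt_id τ).const_mul (2 * c)
    have h := (hasFDerivAt_jacobiTheta₂ (B z τ) hτ').comp_hasDerivAt_of_eq τ (hBt.prodMk hCt) rfl
    refine h.congr_deriv ?_
    have e : ((2 * c * y, 2 * c) : ℂ × ℂ) = (2 * c * y) • (1, 0) + (2 * c) • (0, 1) := by simp
    rw [e, map_add, map_smul, map_smul, fderiv_10 _ hτ']
    simp [j1, jt]
  refine ⟨?_, ?_, ?_, ?_⟩
  · simp only [Th_eq]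
    exact (hE z).mul (hj0 z)
  · exact (((hE z).mul_const _).mul (hj0 z)).add ((hE z).mul (hj1.mul_const d))
  · simp only [Th_eq]
    exact hEt.mul hjt
  · simp only [u]
    field_simp
    ring


lemma norm_q_lt {τ : ℂ} (hτ : 0 < τ.im) : ‖exp (2 * cπ * I * τ)‖ < 1 := by
  rw [Complex.norm_exp, Real.exp_lt_one_iff]
  have : (2 * cπ * I * τ).re = -(2 * Real.pi * τ.im) := by
    simp [cπ]
  rw [this]
  have := Real.pi_pos
  have : 0 < 2 * Real.pi * τ.im := by positivity
  linarith

lemma summable_qx {q : ℂ} (hq : ‖q‖ < 1) (x : ℂ) :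
    Summable fun n : ℕ => ‖-(q ^ (n + 1) * x)‖ := by
  have h := ((summable_geometric_of_lt_one (norm_nonneg q) hq).mul_left (‖q‖ * ‖x‖))
  refine h.congr (fun n => ?_)
  rw [norm_neg, norm_mul, norm_pow]; ring

lemma multipliable_qx {q : ℂ} (hq : ‖q‖ < 1) (x : ℂ) :
    Multipliable fun n : ℕ => (1 - q ^ (n + 1) * x) := by
  have := multipliable_one_add_of_summable (summable_qx hq x)
  simpa [sub_eq_add_neg] using this

lemma exp_int_pi_succ (k : ℤ) : exp (cπ * I * ((k + 1 : ℤ) : ℂ)) = - exp (cπ * I * k) := by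
  have : cπ * I * ((k + 1 : ℤ) : ℂ) = cπ * I * k + Real.pi * I := by
    push_cast [cπ]; ring
  rw [this, exp_add, exp_pi_mul_I]; ring

lemma neg_exp_eq (a : ℂ) : -exp a = exp (cπ * I + a) := by
  rw [exp_add, cπ, exp_pi_mul_I]; ring

lemma real_mul_im_pos {τ : ℂ} (hτ : 0 < τ.im) {r : ℝ} (hr : 0 < r) {c : ℂ} (hc : 2 * c = r) :
    0 < (2 * c * τ).im := by
  rw [hc, Complex.im_ofReal_mul]; positivity

lemma half_im {τ : ℂ} (hτ : 0 < τ.im) : 0 < (2 * (1 / 2 : ℂ) * τ).im := by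
  have : (2 * (1 / 2 : ℂ) * τ) = τ := by ring
  rwa [this]

lemma JTheta1_eq (z τ : ℂ) (hτ : 0 < τ.im) :
    JTheta1 z τ = -I * Th 1 (1 / 2) 1 (1 / 2) z τ := by
  set q := exp (2 * cπ * I * τ) with hqd
  set x := exp (2 * cπ * I * z) with hxd
  have hq : ‖q‖ < 1 := norm_q_lt hτ
  have hq0 : q ≠ 0 := exp_ne_zero _
  have hx0 : x ≠ 0 := exp_ne_zero _
  let e : ℂ := exp (cπ * I * τ / 4 + cπ * I * z)
  have he : e ≠ 0 := exp_ne_zero _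
  let w : ℤ → ℂ := fun k => thT 1 (1/2) 1 (1/2) z τ k / e
  have hw0 : w 0 = 1 := by
    simp only [w, e, thT]
    rw [← exp_sub, exp_eq_one_iff]
    exact ⟨0, by push_cast; ring⟩
  have hw : ∀ k, w (k+1) = -(w k * q^(k+1) * x) := by
    intro k
    have h1 : thT 1 (1/2) 1 (1/2) z τ (k+1) = - (thT 1 (1/2) 1 (1/2) z τ k * q^(k+1) * x) := by
      simp only [thT, hqd, hxd]
      rw [← exp_int_mul, ← exp_add, ← exp_add, neg_exp_eq]
      congr 1
      push_cast [cπ]; ring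
    simp only [w, h1]; ring
  have hws : Summable fun k => ‖w k‖ := by
    have := (thT_summable (s := 1) (c := 1/2) (d := 1) (y := 1/2) (z := z) (half_im hτ)).mul_right (‖e‖⁻¹)
    refine this.congr (fun k => ?_)
    simp only [w, norm_div]; rfl
  have key := jtp hq0 hq hx0 hw0 hw hws
  have hsum : ∑' k, w k = Th 1 (1/2) 1 (1/2) z τ / e := by
    simp only [w, Th]; rw [tsum_div_const]
  have hxinv : exp (-(2 * cπ * I * z)) = x⁻¹ := by rw [exp_neg]
  have hm : Multipliable fun n : ℕ => ((1 - q ^ (n + 1) * x) * (1 - q ^ (n + 1) * x⁻¹) *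
      (1 - q ^ (n + 1))) := by
    have h3 := multipliable_qx hq 1
    simp only [mul_one] at h3
    exact ((multipliable_qx hq x).mul (multipliable_qx hq x⁻¹)).mul h3
  have hlim := hm.hasProd.tendsto_prod_nat
  have hqN : Filter.Tendsto (fun N : ℕ => 1 - q ^ N * x⁻¹) Filter.atTop (nhds (1 - 0 * x⁻¹)) :=
    ((tendsto_pow_atTop_nhds_zero_of_norm_lt_one hq).mul_const _).const_sub _
  have key2 := key.mul hqN
  have hlim2 := hlim.const_mul (1 - x⁻¹)
  have hEq : ∀ N : ℕ, (qPo q N * ∏ n ∈ Finset.range N, ((1 - q^(n+1)*x)*(1 - q^n/x))) * (1 - q ^ N * x⁻¹)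
      = (1 - x⁻¹) * ∏ n ∈ Finset.range N, ((1 - q ^ (n + 1) * x) * (1 - q ^ (n + 1) * x⁻¹) *
      (1 - q ^ (n + 1))) := by
    intro N
    have h1 : (∏ n ∈ Finset.range N, (1 - q^n/x)) * (1 - q ^ N * x⁻¹) =
        (1 - x⁻¹) * ∏ n ∈ Finset.range N, (1 - q^(n+1) * x⁻¹) := by
      have a := Finset.prod_range_succ (fun n => (1 - q^n/x)) N
      have b := Finset.prod_range_succ' (fun n => (1 - q^n/x)) N
      rw [a] at b
      simp only [pow_zero, div_eq_mul_inv, one_mul] at b ⊢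
      rw [b]; ring
    simp only [Finset.prod_mul_distrib, qPo]
    linear_combination (∏ i ∈ Finset.range N, (1 - q ^ (i + 1))) * (∏ i ∈ Finset.range N, (1 - q ^ (i + 1) * x)) * h1
  have := tendsto_nhds_unique (key2.congr hEq) hlim2
  have hsin : 2 * sin (cπ * z) = -I * exp (cπ * I * z) * (1 - x⁻¹) := by
    have h2 : x⁻¹ = exp (-(cπ * I * z)) * exp (-(cπ * I * z)) := by
      rw [hxd, ← exp_neg, ← exp_add]; congr 1; ring
    have h3 : exp (cπ * I * z) * exp (-(cπ * I * z)) = 1 := by rw [← exp_add]; simp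
    rw [h2, sin, show -(cπ * z) * I = -(cπ * I * z) by ring, show (cπ * z) * I = (cπ * I * z) by ring]
    linear_combination (-I * exp (-(cπ * I * z))) * h3
  have hee : e = exp (cπ * I * τ / 4) * exp (cπ * I * z) := exp_add _ _
  unfold JTheta1
  rw [hxinv]
  rw [hsum] at this
  have h5 : Th 1 (1/2) 1 (1/2) z τ = e * ((1 - x⁻¹) * ∏' n : ℕ, ((1 - q ^ (n + 1) * x) * (1 - q ^ (n + 1) * x⁻¹) *
      (1 - q ^ (n + 1)))) := by
    rw [← this]; field_simp; ring
  rw [h5, hee]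
  linear_combination (exp (cπ * I * τ / 4) * ∏' n : ℕ, ((1 - q ^ (n + 1) * x) * (1 - q ^ (n + 1) * x⁻¹) *
      (1 - q ^ (n + 1)))) * hsin

/-- Pentagonal number theorem. -/
lemma pent (τ : ℂ) (hτ : 0 < τ.im) :
    Th 1 (3 / 2) 0 (-1 / 6) 0 τ = exp (cπ * I * τ / 12) * ∏' n : ℕ, (1 - exp (2 * cπ * I * τ) ^ (n + 1)) := by
  set q := exp (2 * cπ * I * τ) with hqd
  have hq : ‖q‖ < 1 := norm_q_lt hτ
  have hq0 : q ≠ 0 := exp_ne_zero _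
  have hq3 : ‖q ^ 3‖ < 1 := by
    rw [norm_pow]; exact pow_lt_one₀ (norm_nonneg _) hq (by norm_num)
  have hx0 : (q⁻¹ ^ 2) ≠ 0 := pow_ne_zero _ (inv_ne_zero hq0)
  let e : ℂ := exp (cπ * I * τ / 12)
  have he : e ≠ 0 := exp_ne_zero _
  let w : ℤ → ℂ := fun k => thT 1 (3/2) 0 (-1/6) 0 τ k / e
  have hw0 : w 0 = 1 := by
    simp only [w, e, thT]
    rw [← exp_sub, exp_eq_one_iff]
    exact ⟨0, by push_cast; ring⟩
  have hw : ∀ k, w (k+1) = -(w k * (q ^ 3)^(k+1) * q⁻¹ ^ 2) := by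
    intro k
    have h1 : thT 1 (3/2) 0 (-1/6) 0 τ (k+1) = - (thT 1 (3/2) 0 (-1/6) 0 τ k * (q ^ 3)^(k+1) * q⁻¹ ^ 2) := by
      have h2 : q⁻¹ ^ 2 = exp (- (2 * (2 * cπ * I * τ))) := by
        rw [hqd, ← exp_neg, ← exp_nat_mul]; congr 1; push_cast; ring
      have h3 : q ^ 3 = exp (3 * (2 * cπ * I * τ)) := by
        rw [hqd, ← exp_nat_mul]; congr 1
      rw [h2, h3]
      simp only [thT]
      rw [← exp_int_mul, ← exp_add, ← exp_add, neg_exp_eq]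
      congr 1
      push_cast [cπ]; ring
    simp only [w, h1]; ring
  have him : 0 < (2 * (3 / 2 : ℂ) * τ).im := by
    exact real_mul_im_pos hτ (r := 3) (by norm_num) (by norm_num)
  have hws : Summable fun k => ‖w k‖ := by
    have := (thT_summable (s := 1) (c := 3/2) (d := 0) (y := -1/6) (z := 0) him).mul_right (‖e‖⁻¹)
    refine this.congr (fun k => ?_)
    simp only [w, norm_div]; rfl
  have key := jtp (pow_ne_zero 3 hq0) hq3 hx0 hw0 hw hws
  have hsum : ∑' k, w k = Th 1 (3/2) 0 (-1/6) 0 τ / e := by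
    simp only [w, Th]; rw [tsum_div_const]
  have hEq : ∀ N : ℕ, qPo (q ^ 3) N * ∏ n ∈ Finset.range N, ((1 - (q ^ 3)^(n+1)*q⁻¹ ^ 2)*(1 - (q ^ 3)^n/q⁻¹ ^ 2))
      = qPo q (N * 3) := by
    intro N
    induction N with
    | zero => simp [qPo]
    | succ N ih =>
      have e1 : qPo q ((N + 1) * 3) = qPo q (N * 3) * ((1 - q ^ (N * 3 + 1)) * (1 - q ^ (N * 3 + 2)) * (1 - q ^ (N * 3 + 3))) := by
        rw [show (N + 1) * 3 = N * 3 + 1 + 1 + 1 by ring]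
        simp only [qPo, Finset.prod_range_succ]; ring
      have e2 : qPo (q ^ 3) (N + 1) = qPo (q ^ 3) N * (1 - q ^ (N * 3 + 3)) := by
        simp only [qPo, Finset.prod_range_succ]; ring
      have e3 : (q ^ 3)^(N+1)*q⁻¹ ^ 2 = q ^ (N * 3 + 1) := by
        field_simp; ring
      have e4 : (q ^ 3)^N/q⁻¹ ^ 2 = q ^ (N * 3 + 2) := by
        field_simp; ring
      rw [Finset.prod_range_succ, e1, e2, ← ih, e3, e4]; ring
  have h3 : Filter.Tendsto (fun N : ℕ => N * 3) Filter.atTop Filter.atTop :=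
    Filter.tendsto_id.atTop_mul_const' (by norm_num)
  have := tendsto_nhds_unique (key.congr hEq) ((qPo_tendsto hq).comp h3)
  rw [hsum, div_eq_iff he] at this
  rw [this]; ring


/-- Logarithm of the eta function. -/
noncomputable def LEta (τ : ℂ) : ℂ := cπ * I * τ / 12 +
    ∑' k : ℕ, Complex.log (1 - exp (2 * cπ * I * τ) ^ (k + 1))

lemma exp_LEta (τ : ℂ) (hτ : 0 < τ.im) : exp (LEta τ) = Th 1 (3 / 2) 0 (-1 / 6) 0 τ := by
  have hq := norm_q_lt hτ
  rw [pent τ hτ, LEta, exp_add]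
  congr 1
  refine Complex.cexp_tsum_eq_tprod (fun n => one_sub_qpow_ne hq n) ?_
  have h := summable_qx hq 1
  simp only [mul_one] at h
  have := Complex.summable_log_one_add_of_summable h.of_norm
  simpa [sub_eq_add_neg] using this

lemma LEta_diff (τ : ℂ) (hτ : 0 < τ.im) : DifferentiableAt ℂ LEta τ := by
  have hd : DifferentiableAt ℂ (fun τ : ℂ => ∑' k : ℕ, Complex.log (1 - exp (2 * cπ * I * τ) ^ (k + 1))) τ := by
    let δ := τ.im / 2
    have hδ : 0 < δ := by positivity
    let U : Set ℂ := {t | δ < t.im}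
    have hU : IsOpen U := isOpen_lt continuous_const continuous_im
    let r : ℝ := Real.exp (-(2 * Real.pi * δ))
    have hr0 : 0 ≤ r := (Real.exp_pos _).le
    have hr1 : r < 1 := by
      rw [Real.exp_lt_one_iff]
      have := Real.pi_pos
      have : 0 < 2 * Real.pi * δ := by positivity
      linarith
    have hqr : ∀ t ∈ U, ‖exp (2 * cπ * I * t)‖ ≤ r := by
      intro t ht
      rw [Complex.norm_exp, Real.exp_le_exp]
      have : (2 * cπ * I * t).re = -(2 * Real.pi * t.im) := by simp [cπ]
      rw [this]
      have h1 : δ < t.im := ht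
      have := Real.pi_pos
      have := mul_lt_mul_of_pos_left h1 (show 0 < 2 * Real.pi by positivity)
      linarith
    let u : ℕ → ℝ := fun k => r ^ (k + 1) * ((1 - r)⁻¹ + 1)
    have hu : Summable u := by
      have := (summable_nat_add_iff 1).2 (summable_geometric_of_lt_one hr0 hr1)
      exact this.mul_right _
    have hz : ∀ (k : ℕ) (t : ℂ), t ∈ U → ‖exp (2 * cπ * I * t) ^ (k + 1)‖ ≤ r ^ (k + 1) := by
      intro k t ht
      rw [norm_pow]
      exact pow_le_pow_left₀ (norm_nonneg _) (hqr t ht) _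
    have hrk : ∀ k : ℕ, r ^ (k + 1) ≤ r := fun k => by
      have := pow_le_pow_of_le_one hr0 hr1.le (show 1 ≤ k + 1 by omega)
      simpa using this
    have hb : ∀ (k : ℕ) (t : ℂ), t ∈ U → ‖Complex.log (1 - exp (2 * cπ * I * t) ^ (k + 1))‖ ≤ u k := by
      intro k t ht
      have h1 := hz k t ht
      have h2 := hrk k
      rw [sub_eq_add_neg]
      have h3 := Complex.norm_log_one_add_le (z := -exp (2 * cπ * I * t) ^ (k + 1))
        (by rw [norm_neg]; linarith)
      rw [norm_neg] at h3
      refine h3.trans ?_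
      set s := ‖exp (2 * cπ * I * t) ^ (k + 1)‖
      have hs0 : 0 ≤ s := norm_nonneg _
      have h4 : (1 - s)⁻¹ ≤ (1 - r)⁻¹ := inv_anti₀ (by linarith) (by linarith)
      have h5 : 0 ≤ (1 - s)⁻¹ := inv_nonneg.2 (by linarith)
      have h6 : s ^ 2 ≤ s := by nlinarith
      have h7 : s ^ 2 * (1 - s)⁻¹ ≤ s * (1 - r)⁻¹ := mul_le_mul h6 h4 h5 hs0
      have h8 : 0 ≤ s ^ 2 * (1 - s)⁻¹ := by positivity
      have h9 : 0 ≤ (1 - r)⁻¹ + 1 := by linarith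
      have h10 := mul_le_mul_of_nonneg_right h1 h9
      simp only [u]
      linarith
    have hf : ∀ k : ℕ, DifferentiableOn ℂ (fun t => Complex.log (1 - exp (2 * cπ * I * t) ^ (k + 1))) U := by
      intro k t ht
      apply DifferentiableAt.differentiableWithinAt
      apply DifferentiableAt.clog
      · fun_prop
      · rw [sub_eq_add_neg]
        apply Complex.mem_slitPlane_of_norm_lt_one
        rw [norm_neg]
        linarith [hz k t ht, hrk k]
    have hτU : τ ∈ U := by
      show τ.im / 2 < τ.im
      linarith
    exact (differentiableOn_tsum_of_summable_norm hu hf hU hb).differentiableAt (hU.mem_nhds hτU)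
  unfold LEta
  exact ((differentiableAt_id.const_mul (cπ * I)).div_const 12).add hd


/-- Reindexing of the double sum. -/
def reMap (x : Fin 3 × (ℤ × ℤ)) : ℤ × ℤ :=
  (2 * x.2.1 + (x.1.val : ℤ) - x.2.2, x.2.2 + x.2.1)

lemma reMap_bij : Function.Bijective reMap := by
  constructor
  · rintro ⟨⟨r, hr⟩, M, l⟩ ⟨⟨r', hr'⟩, M', l'⟩ h
    simp only [reMap, Prod.mk.injEq] at h
    obtain ⟨h1, h2⟩ := h
    have : M = M' := by omega
    have : l = l' := by omega
    have : r = r' := by omega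
    subst_vars; rfl
  · rintro ⟨a, b⟩
    refine ⟨(⟨((a + b) % 3).toNat, by omega⟩, ((a + b) / 3, b - (a + b) / 3)), ?_⟩
    simp only [reMap, Prod.mk.injEq]
    constructor
    · have : (((a + b) % 3).toNat : ℤ) = (a + b) % 3 := Int.toNat_of_nonneg (by omega)
      rw [this]; omega
    · ring

lemma exp_two_pi_int (n : ℤ) (a : ℂ) : exp (a + 2 * cπ * I * n) = exp a := by
  rw [exp_add, show 2 * cπ * I * n = n * (2 * Real.pi * I) by simp only [cπ]; ring,
    exp_int_mul_two_pi_mul_I, mul_one]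

lemma Th_neg (τ y : ℂ) : Th 1 (3 / 2) 0 (-y) 0 τ = Th 1 (3 / 2) 0 y 0 τ := by
  unfold Th
  rw [← (Equiv.neg ℤ).tsum_eq]
  refine tsum_congr (fun k => ?_)
  simp only [thT, Equiv.neg_apply]
  rw [← exp_two_pi_int k]
  congr 1
  push_cast; ring

lemma Th_sub_one (τ y : ℂ) : Th 1 (3 / 2) 0 (y - 1) 0 τ = - Th 1 (3 / 2) 0 y 0 τ := by
  unfold Th
  rw [← (Equiv.addRight (1 : ℤ)).tsum_eq, ← tsum_neg]
  refine tsum_congr (fun k => ?_)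
  simp only [thT, Equiv.coe_addRight]
  rw [neg_exp_eq]
  congr 1
  push_cast; ring

lemma Th_half (τ : ℂ) : Th 1 (3 / 2) 0 (-1 / 2) 0 τ = 0 := by
  have h1 := Th_neg τ (1 / 2)
  have h2 := Th_sub_one τ (1 / 2)
  rw [show (1 / 2 - 1 : ℂ) = -1 / 2 by norm_num] at h2
  rw [show (-(1 / 2) : ℂ) = -1 / 2 by norm_num, h2] at h1
  rw [h2]
  linear_combination (1 / 2) * h1

lemma prod_expand (y z τ : ℂ) (hτ : 0 < τ.im) :
    Th 1 (1 / 2) 1 (1 / 2) z τ * Th 0 1 1 y z τ =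
      ∑ r : Fin 3, exp (cπ * I * (r.val : ℂ)) * (Th 0 3 3 (((r.val : ℂ) + 1 / 2 + y) / 3) z τ *
        Th 1 (3 / 2) 0 (-((r.val : ℂ) + 1 / 2 - 2 * y) / 3) 0 τ) := by
  have s1 := thT_summable (s := 1) (c := 1 / 2) (d := 1) (y := 1 / 2) (z := z)
    (real_mul_im_pos hτ (r := 1) (by norm_num) (by norm_num))
  have s2 := thT_summable (s := 0) (c := 1) (d := 1) (y := y) (z := z)
    (real_mul_im_pos hτ (r := 2) (by norm_num) (by norm_num))
  have s3 := fun y' => thT_summable (s := 0) (c := 3) (d := 3) (y := y') (z := z)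
    (real_mul_im_pos hτ (r := 6) (by norm_num) (by norm_num))
  have s4 := fun y' => thT_summable (s := 1) (c := 3 / 2) (d := 0) (y := y') (z := 0)
    (real_mul_im_pos hτ (r := 3) (by norm_num) (by norm_num))
  have hsum : Summable fun x : ℤ × ℤ => thT 1 (1 / 2) 1 (1 / 2) z τ x.1 * thT 0 1 1 y z τ x.2 :=
    summable_mul_of_summable_norm s1 s2
  have hterm : ∀ (r : Fin 3) (x : ℤ × ℤ),
      thT 1 (1 / 2) 1 (1 / 2) z τ (reMap (r, x)).1 * thT 0 1 1 y z τ (reMap (r, x)).2 =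
      exp (cπ * I * (r.val : ℂ)) * (thT 0 3 3 (((r.val : ℂ) + 1 / 2 + y) / 3) z τ x.1 *
        thT 1 (3 / 2) 0 (-((r.val : ℂ) + 1 / 2 - 2 * y) / 3) 0 τ x.2) := by
    rintro r ⟨M, l⟩
    simp only [thT, reMap]
    rw [← exp_add, ← exp_add, ← exp_add, ← exp_two_pi_int (M - l)
      (cπ * I * (r.val : ℂ) + _)]
    congr 1
    push_cast; ring
  unfold Th
  rw [tsum_mul_tsum_of_summable_norm s1 s2]
  rw [← (Equiv.ofBijective reMap reMap_bij).tsum_eq]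
  have hsum2 := (Equiv.ofBijective reMap reMap_bij).summable_iff.2 hsum
  have hsum3 : Summable fun x : Fin 3 × (ℤ × ℤ) =>
    thT 1 (1 / 2) 1 (1 / 2) z τ (reMap x).1 * thT 0 1 1 y z τ (reMap x).2 := hsum2
  simp only [Equiv.ofBijective_apply]
  rw [hsum3.tsum_prod, tsum_fintype]
  refine Finset.sum_congr rfl (fun r _ => ?_)
  simp only [hterm]
  rw [tsum_mul_left, tsum_mul_tsum_of_summable_norm (s3 _) (s4 _)]

lemma ThetaKN_eq (j : ℕ) (z τ : ℂ) : ThetaKN 1 (j : ℤ) z τ = Th 0 1 1 ((j : ℂ) / 2) z τ := by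
  unfold ThetaKN Th
  refine tsum_congr (fun k => ?_)
  simp only [thT]
  congr 1
  push_cast; ring

lemma theta_prod (j : ℕ) (hj : j ≤ 1) : ∃ Q : ℂ → ℂ → ℂ, Heat (6 * cπ * I) Q ∧
    ∀ z τ : ℂ, 0 < τ.im → JTheta1 z τ * ThetaKN 1 (j : ℤ) z τ = exp (LEta τ) * Q z τ := by
  have hH : ∀ y, Heat (6 * cπ * I) (Th 0 3 3 y) := by
    intro y
    have := Th_heat (s := 0) (c := 3) (d := 3) (y := y) (by norm_num)
      (fun τ hτ => real_mul_im_pos hτ (r := 6) (by norm_num) (by norm_num))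
    rw [show 2 * cπ * I * 3 ^ 2 / 3 = 6 * cπ * I by ring] at this
    exact this
  have e2 : exp (cπ * I * 2) = 1 := by
    have := exp_two_pi_int 1 0
    rw [show cπ * I * 2 = 0 + 2 * cπ * I * ((1 : ℤ) : ℂ) by push_cast; ring, this, exp_zero]
  have e1 : exp (cπ * I) = -1 := by rw [cπ, exp_pi_mul_I]
  have h12 : ∀ τ, Th 1 (3 / 2) 0 (1 / 2) 0 τ = 0 := by
    intro τ
    rw [← Th_neg, show (-(1 / 2) : ℂ) = -1 / 2 by norm_num, Th_half]
  have h56 : ∀ τ, Th 1 (3 / 2) 0 (5 / 6) 0 τ = - Th 1 (3 / 2) 0 (1 / 6) 0 τ := by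
    intro τ
    have a := Th_sub_one τ (1 / 6)
    rw [← a, ← Th_neg]; norm_num
  interval_cases j
  · refine ⟨_, ((hH (1 / 6)).sub (hH (5 / 6))).const_mul (-I), fun z τ hτ => ?_⟩
    have := prod_expand 0 z τ hτ
    rw [JTheta1_eq z τ hτ, ThetaKN_eq, exp_LEta τ hτ]
    simp only [Fin.sum_univ_three] at this
    norm_num [e1, e2, Th_neg, h12, h56] at this ⊢
    linear_combination I * this
  · refine ⟨_, ((hH (1 / 3)).sub (hH (2 / 3))).const_mul (-I), fun z τ hτ => ?_⟩
    have := prod_expand (1 / 2) z τ hτ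
    rw [JTheta1_eq z τ hτ, ThetaKN_eq, exp_LEta τ hτ]
    simp only [Fin.sum_univ_three] at this
    norm_num [e1, e2, Th_neg, h12, h56] at this ⊢
    linear_combination I * this


lemma JTheta1_heat : Heat (4 * cπ * I) JTheta1 := by
  have := Th_heat (s := 1) (c := 1 / 2) (d := 1) (y := 1 / 2) (by norm_num)
      (fun τ hτ => real_mul_im_pos hτ (r := 1) (by norm_num) (by norm_num))
  rw [show 2 * cπ * I * 1 ^ 2 / (1 / 2) = 4 * cπ * I by ring] at this
  exact (this.const_mul (-I)).congr (fun z τ hτ => JTheta1_eq z τ hτ)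

lemma ThetaKN_heat (j : ℕ) : Heat (2 * cπ * I) (ThetaKN 1 (j : ℤ)) := by
  have := Th_heat (s := 0) (c := 1) (d := 1) (y := (j : ℂ) / 2) (by norm_num)
      (fun τ hτ => real_mul_im_pos hτ (r := 2) (by norm_num) (by norm_num))
  rw [show 2 * cπ * I * 1 ^ 2 / 1 = 2 * cπ * I by ring] at this
  exact this.congr (fun z τ _ => ThetaKN_eq j z τ)

theorem KZB_kappa_2p3 (p : ℕ) (j : ℕ) (hj : j ≤ 1) :
    ∀ z τ : ℂ, 0 < τ.im → JTheta1 z τ ≠ 0 →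
      KZB (2 * p + 3) p (fun w t =>
        EtaPow (-(3 * ((p : ℝ) + 1)) / (2 * (p : ℝ) + 3)) t *
          JTheta1 w t ^ (p + 1) * ThetaKN 1 (j : ℤ) w t) z τ := by
  intro z τ hτ hne
  obtain ⟨Q, ⟨Q1, Q2, Qt, hQ⟩, hPQ⟩ := theta_prod j hj
  obtain ⟨A1, A2, At, hA⟩ := JTheta1_heat
  obtain ⟨B1, B2, Bt, hB⟩ := ThetaKN_heat j
  have hL := (LEta_diff τ hτ).hasDerivAt
  set L' := deriv LEta τ
  set f := JTheta1 with hf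
  set g := ThetaKN 1 (j : ℤ) with hg
  -- first derivative identity
  have k1 : ∀ w, A1 w τ * g w τ + f w τ * B1 w τ = exp (LEta τ) * Q1 w τ := by
    intro w
    have a := (hA w τ hτ).1.mul (hB w τ hτ).1
    have b := (hQ w τ hτ).1.const_mul (exp (LEta τ))
    have e : ((fun w => f w τ) * fun w => g w τ) = fun w => exp (LEta τ) * Q w τ := by
      funext w; exact hPQ w τ hτ
    rw [e] at a
    exact a.unique b
  have k2 : A2 z τ * g z τ + A1 z τ * B1 z τ + (A1 z τ * B1 z τ + f z τ * B2 z τ) =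
      exp (LEta τ) * Q2 z τ := by
    have a := ((hA z τ hτ).2.1.mul (hB z τ hτ).1).add ((hA z τ hτ).1.mul (hB z τ hτ).2.1)
    have b := (hQ z τ hτ).2.1.const_mul (exp (LEta τ))
    have e : (((fun w => A1 w τ) * fun w => g w τ) + (fun w => f w τ) * fun w => B1 w τ) =
        fun w => exp (LEta τ) * Q1 w τ := by
      funext w; exact k1 w
    rw [e] at a
    exact a.unique b
  have k3 : At z τ * g z τ + f z τ * Bt z τ =
      (exp (LEta τ) * L') * Q z τ + exp (LEta τ) * Qt z τ := by
    have a := (hA z τ hτ).2.2.1.mul (hB z τ hτ).2.2.1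
    have b := hL.cexp.mul (hQ z τ hτ).2.2.1
    have e : ((fun t => exp (LEta t)) * fun t => Q z t) =ᶠ[nhds τ] ((fun t => f z t) * fun t => g z t) := by
      filter_upwards [(isOpen_lt continuous_const continuous_im).mem_nhds hτ] with t ht
      exact (hPQ z t ht).symm
    exact a.unique (b.congr_of_eventuallyEq e.symm)
  have hP := hPQ z τ hτ
  have hA2 := (hA z τ hτ).2.2.2
  have hB2 := (hB z τ hτ).2.2.2
  have hQ2 := (hQ z τ hτ).2.2.2
  have K : A2 z τ * g z τ + 2 * (A1 z τ * B1 z τ) + f z τ * B2 z τ =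
      6 * cπ * I * (At z τ * g z τ + f z τ * Bt z τ - L' * (f z τ * g z τ)) := by
    rw [k3, hP]
    rw [hQ2] at k2
    linear_combination k2
  -- the exponent
  set c : ℝ := -(3 * ((p : ℝ) + 1)) / (2 * (p : ℝ) + 3) with hc
  have hcκ : (c : ℂ) * (2 * (p : ℂ) + 3) = -(3 * ((p : ℂ) + 1)) := by
    have : c * (2 * (p : ℝ) + 3) = -(3 * ((p : ℝ) + 1)) := by
      rw [hc]; field_simp
    exact_mod_cast this
  have hE : HasDerivAt (fun t => EtaPow c t) (EtaPow c τ * ((c : ℂ) * L')) τ :=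
    (hL.const_mul (c : ℂ)).cexp
  set E := EtaPow c τ with hEd
  -- tau derivative
  have dτ : deriv (fun t => EtaPow c t * f z t ^ (p + 1) * g z t) τ =
      (E * ((c : ℂ) * L') * f z τ ^ (p + 1) + E * (((p : ℂ) + 1) * f z τ ^ p * At z τ)) * g z τ
        + E * f z τ ^ (p + 1) * Bt z τ := by
    have h1 := (hA z τ hτ).2.2.1.pow (p + 1)
    have h2 := (hE.mul h1).mul (hB z τ hτ).2.2.1
    refine Eq.trans (HasDerivAt.deriv h2) ?_
    simp only [Pi.mul_apply, Pi.pow_apply, Nat.add_sub_cancel]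
    push_cast
    ring
  -- z derivatives
  have d1 : ∀ w, HasDerivAt (fun w => E * f w τ ^ (p + 1) * g w τ)
      (E * (((p : ℂ) + 1) * (f w τ ^ p * (A1 w τ * g w τ)) + f w τ ^ (p + 1) * B1 w τ)) w := by
    intro w
    have h1 := (hA w τ hτ).1.pow (p + 1)
    have h2 := (h1.const_mul E).mul (hB w τ hτ).1
    refine h2.congr_deriv ?_
    simp only [Pi.mul_apply, Pi.pow_apply, Nat.add_sub_cancel]
    push_cast
    ring
  have d2 : HasDerivAt (fun w => E * (((p : ℂ) + 1) * (f w τ ^ p * (A1 w τ * g w τ)) + f w τ ^ (p + 1) * B1 w τ))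
      (E * (((p : ℂ) + 1) * (((p : ℂ) * f z τ ^ (p - 1) * A1 z τ) * (A1 z τ * g z τ) +
        f z τ ^ p * (A2 z τ * g z τ + A1 z τ * B1 z τ)) +
        (((p : ℂ) + 1) * f z τ ^ p * A1 z τ * B1 z τ + f z τ ^ (p + 1) * B2 z τ))) z := by
    have h0 := (hA z τ hτ).1.pow p
    have h1 := (hA z τ hτ).1.pow (p + 1)
    have h2 := (hA z τ hτ).2.1.mul (hB z τ hτ).1
    have h3 := (((h0.mul h2).const_mul ((p : ℂ) + 1)).add (h1.mul (hB z τ hτ).2.1)).const_mul E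
    refine h3.congr_deriv ?_
    simp only [Pi.mul_apply, Pi.pow_apply, Nat.add_sub_cancel]
    push_cast
    ring
  have d1' := funext (fun w => (d1 w).deriv)
  have dz : iteratedDeriv 2 (fun w => E * f w τ ^ (p + 1) * g w τ) z =
      (E * (((p : ℂ) + 1) * (((p : ℂ) * f z τ ^ (p - 1) * A1 z τ) * (A1 z τ * g z τ) +
        f z τ ^ p * (A2 z τ * g z τ + A1 z τ * B1 z τ)) +
        (((p : ℂ) + 1) * f z τ ^ p * A1 z τ * B1 z τ + f z τ ^ (p + 1) * B2 z τ))) := by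
    rw [iteratedDeriv_succ, iteratedDeriv_one, d1']
    exact d2.deriv
  have hR : Rho' z τ = (A2 z τ * f z τ - A1 z τ * A1 z τ) / f z τ ^ 2 := by
    unfold Rho'
    have e : (fun w => Rho w τ) = (fun w => A1 w τ) / fun w => f w τ := by
      funext w
      simp only [Rho, Pi.div_apply]
      rw [(hA w τ hτ).1.deriv]
    rw [e]
    exact ((hA z τ hτ).2.1.div (hA z τ hτ).1 hne).deriv
  unfold KZB
  beta_reduce
  rw [dτ, dz, hR, ← hEd]
  have hT : (p : ℂ) * f z τ ^ (p - 1) = (p : ℂ) * f z τ ^ p / f z τ := by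
    rw [eq_div_iff hne]
    cases p with
    | zero => simp
    | succ n => simp [pow_succ, mul_assoc]
  rw [hT]
  rw [pow_succ]
  push_cast
  rw [hA2, hB2] at K
  rw [hA2, hB2]
  generalize f z τ ^ p = W at *
  generalize hF : f z τ = F at *
  generalize g z τ = G at *
  generalize A1 z τ = a1 at *
  generalize At z τ = at' at *
  generalize B1 z τ = b1 at *
  generalize Bt z τ = bt at *
  have e : E * ((↑p + 1) * (↑p * W / F * a1 * (a1 * G) + W * (4 * cπ * I * at' * G + a1 * b1)) +
        ((↑p + 1) * W * a1 * b1 + W * F * (2 * cπ * I * bt))) +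
      ↑p * (↑p + 1) * ((4 * cπ * I * at' * F - a1 * a1) / F ^ 2) * (E * (W * F) * G) =
      E * W * (((p : ℂ) + 1) ^ 2 * (4 * cπ * I * at' * G) + 2 * ((p : ℂ) + 1) * a1 * b1 +
        F * (2 * cπ * I * bt)) := by
    field_simp
    ring
  rw [e]
  linear_combination (-(E * W * ((p : ℂ) + 1))) * K + 2 * cπ * I * L' * E * W * F * G * hcκ
end

section
/- Let p ≥ 0 be an integer and κ = 2p+4. Define, for real c, the function g_c(τ) = exp(c·((1/2)·log 2 + Σ_{k=1}^∞ (Log(1 + e^{2πikτ}) − Log(1 − e^{2πikτ})))), where Log is the principal logarithm; g_c is a holomorphic function of τ ∈ ℍ equal to (φ₃(τ)/η(τ))^c, i.e. a branch of the c-th power of √2·∏_{k=1}^∞ (1+q^k)/(1−q^k). Then the function v(λ,τ) = g_{4(p+1)/κ}(τ) · ϑ₁(λ,τ)^{p+1} · θ^s_{2,1}(λ,τ) satisfies the KZB heat equation with parameters κ and p, namely 2πiκ ∂v/∂τ(λ,τ) = ∂²v/∂λ²(λ,τ) + p(p+1)ρ′(λ,τ)v(λ,τ), at every (λ,τ) ∈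 ℂ×ℍ with ϑ₁(λ,τ) ≠ 0. -/
open Complex

/-- A branch of `(φ₃(τ)/η(τ))^c` for real `c`, defined as
`exp(c((1/2)log 2 + Σ_{k≥1}(Log(1 + e^{2πikτ}) - Log(1 - e^{2πikτ}))))`
with the principal logarithm; this is a branch of the `c`-th power of
`√2 ∏_{k≥1}(1+q^k)/(1-q^k)`. -/
noncomputable def GPow (c : ℝ) (τ : ℂ) : ℂ :=
  exp ((c : ℂ) * ((Real.log 2 : ℂ) / 2 +
    ∑' k : ℕ, (Complex.log (1 + exp (2 * cπ * I * τ) ^ (k + 1)) -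
      Complex.log (1 - exp (2 * cπ * I * τ) ^ (k + 1)))))


/-! ### Finite `q`-binomial theorem and the Jacobi triple product -/

namespace KZBaux

/-- Gaussian binomials. -/
noncomputable def gb (q : ℂ) : ℕ → ℕ → ℂ
  | _, 0 => 1
  | 0, _ + 1 => 0
  | N + 1, k + 1 => q ^ (k + 1) * gb q N (k + 1) + gb q N k

/-- `∏_{k ≤ n} (1 - q^k)`. -/
noncomputable def qf (q : ℂ) (n : ℕ) : ℂ := ∏ k ∈ Finset.range n, (1 - q ^ (k + 1))

lemma gb_zero (q : ℂ) (N : ℕ) : gb q N 0 = 1 := by cases N <;> simp [gb]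

lemma gb_of_lt (q : ℂ) : ∀ N k : ℕ, N < k → gb q N k = 0
  | _, 0, h => by omega
  | 0, _ + 1, _ => by simp [gb]
  | N + 1, k + 1, h => by
    rw [gb, gb_of_lt q N (k + 1) (by omega), gb_of_lt q N k (by omega)]; simp

lemma gb_self (q : ℂ) : ∀ N : ℕ, gb q N N = 1
  | 0 => by simp [gb]
  | N + 1 => by rw [gb, gb_of_lt q N (N + 1) (by omega), gb_self q N]; simp

lemma qf_succ (q : ℂ) (n : ℕ) : qf q (n + 1) = qf q n * (1 - q ^ (n + 1)) := by
  simp [qf, Finset.prod_range_succ]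

lemma qf_zero (q : ℂ) : qf q 0 = 1 := by simp [qf]

lemma gb_mul (q : ℂ) : ∀ N a b : ℕ, a + b = N → gb q N a * qf q a * qf q b = qf q N
  | N, 0, b, h => by
    obtain rfl : b = N := by omega
    simp [gb_zero, qf_zero]
  | N, a, 0, h => by
    obtain rfl : a = N := by omega
    simp [gb_self, qf_zero]
  | 0, a + 1, b + 1, h => by omega
  | N + 1, a + 1, b + 1, h => by
    have h1 := gb_mul q N (a + 1) b (by omega)
    have h2 := gb_mul q N a (b + 1) (by omega)
    rw [gb, qf_succ q N, qf_succ q a, qf_succ q b]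
    rw [qf_succ] at h1 h2
    have : q ^ (N + 1) = q ^ (a + 1) * q ^ (b + 1) := by rw [← pow_add]; congr 1; omega
    rw [this]
    linear_combination q ^ (a + 1) * (1 - q ^ (b + 1)) * h1 + (1 - q ^ (a + 1)) * h2

lemma qbinom (q : ℂ) (N : ℕ) : ∀ x : ℂ, ∏ k ∈ Finset.range N, (1 + x * q ^ k) =
    ∑ k ∈ Finset.range (N + 1), q ^ (k.choose 2) * gb q N k * x ^ k := by
  induction N with
  | zero => intro x; simp [gb]
  | succ N ih =>
    intro x
    rw [Finset.prod_range_succ']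
    have e1 : ∏ k ∈ Finset.range N, (1 + x * q ^ (k + 1)) =
        ∏ k ∈ Finset.range N, (1 + (x * q) * q ^ k) := by
      refine Finset.prod_congr rfl fun k _ => ?_
      ring
    rw [e1, ih, Finset.sum_range_succ' _ (N + 1)]
    have e2 : ∑ k ∈ Finset.range (N + 1),
        q ^ ((k + 1).choose 2) * gb q (N + 1) (k + 1) * x ^ (k + 1) =
        (∑ k ∈ Finset.range (N + 1), q ^ ((k + 1).choose 2) * gb q N (k + 1) * (x * q) ^ (k + 1)) +
        x * ∑ k ∈ Finset.range (N + 1), q ^ (k.choose 2) * gb q N k * (x * q) ^ k := by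
      rw [Finset.mul_sum, ← Finset.sum_add_distrib]
      refine Finset.sum_congr rfl fun k _ => ?_
      have : (k + 1).choose 2 = k + k.choose 2 := by
        rw [Nat.choose_succ_succ' k 1]; simp
      rw [gb, this]
      ring
    have e3 : (∑ k ∈ Finset.range (N + 1),
        q ^ ((k + 1).choose 2) * gb q N (k + 1) * (x * q) ^ (k + 1)) + 1 =
        ∑ k ∈ Finset.range (N + 1), q ^ (k.choose 2) * gb q N k * (x * q) ^ k := by
      have := Finset.sum_range_succ' (fun k => q ^ (k.choose 2) * gb q N k * (x * q) ^ k) (N + 1)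
      rw [Finset.sum_range_succ, gb_of_lt q N (N + 1) (by omega)] at this
      simp [gb_zero] at this
      simpa using this.symm
    rw [e2]
    simp only [Nat.choose_zero_succ, pow_zero, gb_zero, mul_one]
    linear_combination -e3

/-- The general term of the theta series. -/
noncomputable def tt (u v : ℂ) (j : ℤ) : ℂ :=
  exp (((j : ℂ) ^ 2 - j) / 2 * v + j * u)

/-- finite triple product; `x = exp u`, `q = exp v` -/
lemma finite_triple (u v : ℂ) (m : ℕ) :
    (∏ k ∈ Finset.range m, (1 + exp u * exp v ^ k)) *
      (∏ k ∈ Finset.range m, (1 + exp v ^ (k + 1) * exp (-u))) =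
    ∑ k ∈ Finset.range (2 * m + 1), gb (exp v) (2 * m) k * tt u v ((k : ℤ) - m) := by
  have h := qbinom (exp v) (2 * m) (exp (u - m * v))
  have hs : ∏ k ∈ Finset.range (2 * m), (1 + exp (u - m * v) * exp v ^ k) =
      (∏ k ∈ Finset.range m, (1 + exp (u - m * v) * exp v ^ k)) *
        ∏ k ∈ Finset.range m, (1 + exp u * exp v ^ k) := by
    rw [two_mul, Finset.prod_range_add]
    congr 1
    refine Finset.prod_congr rfl fun k _ => ?_
    rw [← exp_nat_mul, ← exp_nat_mul, ← exp_add, ← exp_add]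
    congr 2; push_cast; ring
  have hr : ∀ n : ℕ, ∏ k ∈ Finset.range n, (1 + exp (u - n * v) * exp v ^ k) =
      exp (n * u - (n : ℂ) * (n + 1) / 2 * v) *
        ∏ k ∈ Finset.range n, (1 + exp v ^ (k + 1) * exp (-u)) := by
    intro n
    induction n with
    | zero => simp
    | succ n ih =>
      rw [Finset.prod_range_succ', Finset.prod_range_succ]
      have : ∏ k ∈ Finset.range n, (1 + exp (u - ((n + 1 : ℕ) : ℂ) * v) * exp v ^ (k + 1)) =
          ∏ k ∈ Finset.range n, (1 + exp (u - n * v) * exp v ^ k) := by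
        refine Finset.prod_congr rfl fun k _ => ?_
        rw [← exp_nat_mul, ← exp_nat_mul, ← exp_add, ← exp_add]
        congr 2; push_cast; ring
      rw [this, ih]
      have e : exp (((n + 1 : ℕ) : ℂ) * u - ((n + 1 : ℕ) : ℂ) * (((n + 1 : ℕ) : ℂ) + 1) / 2 * v) =
         exp (n * u - (n : ℂ) * (n + 1) / 2 * v) * exp (u - (n + 1) * v) := by
        rw [← exp_add]; congr 1; push_cast; ring
      have e' : exp (u - (n + 1) * v) * (exp v ^ (n + 1) * exp (-u)) = 1 := by
        rw [← exp_nat_mul, ← exp_add, ← exp_add]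
        have : u - (n + 1) * v + (((n + 1 : ℕ) : ℂ) * v + -u) = 0 := by push_cast; ring
        rw [this, exp_zero]
      rw [e]
      push_cast
      linear_combination (-exp (n * u - (n : ℂ) * (n + 1) / 2 * v) *
        ∏ k ∈ Finset.range n, (1 + exp v ^ (k + 1) * exp (-u))) * e'
  rw [hs, hr m] at h
  have hne := exp_ne_zero (m * u - (m : ℂ) * (m + 1) / 2 * v)
  apply mul_left_cancel₀ hne
  rw [Finset.mul_sum]
  calc _ = _ := by ring
    _ = _ := h
    _ = _ := by
      refine Finset.sum_congr rfl fun k _ => ?_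
      have hc : ((k.choose 2 : ℕ) : ℂ) = (k : ℂ) * (k - 1) / 2 := by
        rw [Nat.cast_choose_two]
      have : exp v ^ (k.choose 2) * exp (u - m * v) ^ k =
         exp (m * u - (m : ℂ) * (m + 1) / 2 * v) * tt u v ((k : ℤ) - m) := by
        rw [tt, ← exp_nat_mul, ← exp_nat_mul, ← exp_add, ← exp_add, hc]
        congr 1; push_cast; ring
      linear_combination gb (exp v) (2 * m) k * this

/-- Coefficients in the finite triple product. -/
noncomputable def bb (q : ℂ) (m : ℕ) (j : ℤ) : ℂ :=
  if |j| ≤ m then qf q m * gb q (2 * m) ((m + j).toNat) else 0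

lemma finite_triple' (u v : ℂ) (m : ℕ) :
    (∏ k ∈ Finset.range m, (1 + exp u * exp v ^ k)) *
      (∏ k ∈ Finset.range m, (1 + exp v ^ (k + 1) * exp (-u))) * qf (exp v) m =
    ∑' j : ℤ, bb (exp v) m j * tt u v j := by
  rw [finite_triple, tsum_eq_sum (s := Finset.Icc (-(m : ℤ)) m), Finset.sum_mul]
  · refine Finset.sum_nbij' (fun k => (k : ℤ) - m) (fun j => (m + j).toNat) ?_ ?_ ?_ ?_ ?_
    · intro k hk; simp at hk ⊢; omega
    · intro k hk; simp at hk ⊢; omega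
    · intro k hk; simp
    · intro k hk; simp at hk ⊢; omega
    · intro k hk
      simp at hk
      have h1 : |(k : ℤ) - m| ≤ m := by rw [abs_le]; omega
      simp only [bb, h1, if_true]
      have : ((m : ℤ) + (k - m)).toNat = k := by omega
      rw [this]; ring
  · intro j hj
    have : ¬ |j| ≤ m := by rw [abs_le]; simpa using hj
    simp [bb, this]

lemma qf_ne_zero {q : ℂ} (hq : ‖q‖ < 1) (n : ℕ) : 1 - q ^ (n + 1) ≠ 0 := by
  intro h
  have : q ^ (n + 1) = 1 := by linear_combination -h
  have h2 := congrArg norm this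
  rw [norm_pow, norm_one] at h2
  have := pow_lt_one₀ (norm_nonneg q) hq (Nat.succ_ne_zero n)
  simp at this
  linarith

lemma summ_pow {q : ℂ} (hq : ‖q‖ < 1) : Summable fun n : ℕ => ‖q ^ (n + 1)‖ := by
  simpa using (summable_nat_add_iff 1).mpr (summable_geometric_of_lt_one (norm_nonneg _) hq)

lemma qf_tendsto {q : ℂ} (hq : ‖q‖ < 1) : ∃ Q : ℂ, Q ≠ 0 ∧
    Filter.Tendsto (qf q) Filter.atTop (nhds Q) := by
  refine ⟨∏' n : ℕ, (1 - q ^ (n + 1)), ?_, ?_⟩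
  · have := tprod_one_add_ne_zero_of_summable (f := fun n : ℕ ↦ -q ^ (n + 1))
      (fun n => by simpa [← sub_eq_add_neg] using qf_ne_zero hq n) (by simpa using summ_pow hq)
    simpa [← sub_eq_add_neg] using this
  · exact (ModularForm.multipliable_one_sub_pow hq).hasProd.tendsto_prod_nat

lemma qf_ne {q : ℂ} (hq : ‖q‖ < 1) (n : ℕ) : qf q n ≠ 0 :=
  Finset.prod_ne_zero_iff.2 fun k _ => qf_ne_zero hq k

lemma bb_eq {q : ℂ} (hq : ‖q‖ < 1) (m : ℕ) (j : ℤ) (h : |j| ≤ m) :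
    bb q m j = qf q m * qf q (2 * m) * (qf q (m + j).toNat)⁻¹ * (qf q (m - j).toNat)⁻¹ := by
  rw [abs_le] at h
  have := gb_mul q (2 * m) (m + j).toNat (m - j).toNat (by omega)
  rw [bb, if_pos (by rw [abs_le]; exact h), ← this]
  have h1 := qf_ne hq (m + j).toNat
  have h2 := qf_ne hq (m - j).toNat
  field_simp

lemma bb_tendsto {q : ℂ} (hq : ‖q‖ < 1) (j : ℤ) :
    Filter.Tendsto (fun m => bb q m j) Filter.atTop (nhds 1) := by
  obtain ⟨Q, hQ, hT⟩ := qf_tendsto hq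
  have key : Filter.Tendsto (fun m : ℕ => qf q m * qf q (2 * m) * (qf q (m + j).toNat)⁻¹ *
      (qf q (m - j).toNat)⁻¹) Filter.atTop (nhds (Q * Q * Q⁻¹ * Q⁻¹)) := by
    refine ((hT.mul (hT.comp ?_)).mul ((hT.comp ?_).inv₀ hQ)).mul ((hT.comp ?_).inv₀ hQ)
    · exact Filter.tendsto_atTop_mono (fun m => by simp only [id]; omega) Filter.tendsto_id
    · refine Filter.tendsto_atTop.2 fun b => ?_
      filter_upwards [Filter.eventually_ge_atTop (b + j.natAbs)] with m hm
      omega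
    · refine Filter.tendsto_atTop.2 fun b => ?_
      filter_upwards [Filter.eventually_ge_atTop (b + j.natAbs)] with m hm
      omega
  have : Q * Q * Q⁻¹ * Q⁻¹ = 1 := by field_simp
  rw [this] at key
  refine key.congr' ?_
  filter_upwards [Filter.eventually_ge_atTop j.natAbs] with m hm
  rw [bb_eq hq m j (by rw [abs_le]; omega)]

lemma bb_bound {q : ℂ} (hq : ‖q‖ < 1) : ∃ C : ℝ, ∀ m j, ‖bb q m j‖ ≤ C := by
  obtain ⟨Q, hQ, hT⟩ := qf_tendsto hq
  obtain ⟨A, hA⟩ := (Metric.isBounded_range_of_tendsto _ hT).exists_norm_le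
  obtain ⟨B, hB⟩ := (Metric.isBounded_range_of_tendsto _ (hT.inv₀ hQ)).exists_norm_le
  have hA' : ∀ n, ‖qf q n‖ ≤ A := fun n => hA _ ⟨n, rfl⟩
  have hB' : ∀ n, ‖(qf q n)⁻¹‖ ≤ B := fun n => hB _ ⟨n, rfl⟩
  have hA0 : 0 ≤ A := (norm_nonneg _).trans (hA' 0)
  have hB0 : 0 ≤ B := (norm_nonneg _).trans (hB' 0)
  refine ⟨A * A * B * B, fun m j => ?_⟩
  by_cases h : |j| ≤ m
  · rw [bb_eq hq m j h, norm_mul, norm_mul, norm_mul]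
    gcongr <;> first | apply hA' | apply hB'
  · simp only [bb, h, if_false, norm_zero]; positivity

lemma triple_product (u v : ℂ) (hv : ‖exp v‖ < 1) (hs : Summable fun j => ‖tt u v j‖) :
    ∑' j : ℤ, tt u v j = (1 + exp u) * ∏' n : ℕ, ((1 + exp v ^ (n + 1) * exp u) *
      (1 + exp v ^ (n + 1) * exp (-u)) * (1 - exp v ^ (n + 1))) := by
  obtain ⟨C, hC⟩ := bb_bound hv
  have h1 : Filter.Tendsto (fun m => ∑' j : ℤ, bb (exp v) m j * tt u v j) Filter.atTop
      (nhds (∑' j : ℤ, tt u v j)) := by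
    refine tendsto_tsum_of_dominated_convergence (bound := fun j => C * ‖tt u v j‖)
      (hs.mul_left C) (fun j => ?_) (Filter.Eventually.of_forall fun m j => ?_)
    · simpa using (bb_tendsto hv j).mul_const (tt u v j)
    · rw [norm_mul]
      exact mul_le_mul_of_nonneg_right (hC m j) (norm_nonneg _)
  have hp : Filter.Tendsto (fun m => exp v ^ (m + 1)) Filter.atTop (nhds 0) :=
    (tendsto_pow_atTop_nhds_zero_of_norm_lt_one hv).comp (Filter.tendsto_add_atTop_nat 1)
  have hsum := summ_pow hv
  have m1 : Multipliable fun n : ℕ => 1 + exp v ^ (n + 1) * exp u := by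
    apply multipliable_one_add_of_summable
    simpa only [norm_mul] using hsum.mul_right ‖exp u‖
  have m2 : Multipliable fun n : ℕ => 1 + exp v ^ (n + 1) * exp (-u) := by
    apply multipliable_one_add_of_summable
    simpa only [norm_mul] using hsum.mul_right ‖exp (-u)‖
  have m3 := ModularForm.multipliable_one_sub_pow hv
  have m4 := ((m1.mul m2).mul m3).hasProd.tendsto_prod_nat
  have h2 := (m4.mul ((hp.mul_const (exp (-u))).const_add 1)).mul (hp.const_sub 1)
  have h3 := h2.const_mul (1 + exp u)
  simp only [zero_mul, add_zero, sub_zero, mul_one] at h3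
  have h4 := h1.comp (Filter.tendsto_add_atTop_nat 1)
  refine tendsto_nhds_unique h4 (h3.congr fun m => ?_)
  rw [Function.comp_apply, ← finite_triple', Finset.prod_range_succ', Finset.prod_range_succ, qf_succ]
  rw [Finset.prod_mul_distrib, Finset.prod_mul_distrib, qf]
  simp only [mul_comm (exp u), pow_zero, one_mul]
  ring

end KZBaux

namespace KZBaux

lemma cpi_eq : cπ = (Real.pi : ℂ) := rfl

/-- general term of the second theta function -/
noncomputable def FF (j : ℤ) (z τ : ℂ) : ℂ :=
  exp (cπ * I * τ * ((j : ℂ) - 1 / 2) ^ 2 + 2 * cπ * I * ((j : ℂ) - 1 / 2) * z)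

/-- the second theta function -/
noncomputable def T0 (z τ : ℂ) : ℂ := ∑' j : ℤ, FF j z τ
/-- its first `z`-derivative -/
noncomputable def T1 (z τ : ℂ) : ℂ := ∑' j : ℤ, (2 * cπ * I * ((j : ℂ) - 1 / 2)) * FF j z τ
/-- its second `z`-derivative -/
noncomputable def T2 (z τ : ℂ) : ℂ := ∑' j : ℤ, (2 * cπ * I * ((j : ℂ) - 1 / 2)) ^ 2 * FF j z τ

lemma FF_eq (j : ℤ) (z τ : ℂ) :
    FF j z τ = exp (cπ * I * τ / 4 - cπ * I * z) * jacobiTheta₂_term j (z - τ / 2) τ := by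
  rw [FF, jacobiTheta₂_term, ← exp_add, cpi_eq]
  congr 1; ring

/-- summable majorant -/
noncomputable def uu (S T M : ℝ) (j : ℤ) : ℝ :=
  Real.exp (Real.pi * S) * Real.exp (-Real.pi * (T * j ^ 2 - 2 * (S + M) * |j|))

lemma uu_nonneg (S T M : ℝ) (j : ℤ) : 0 ≤ uu S T M j := by unfold uu; positivity

lemma uu_summable (S : ℝ) {T : ℝ} (M : ℝ) (hT : 0 < T) : Summable (uu S T M) := by
  have := (summable_pow_mul_jacobiTheta₂_term_bound (S + M) hT 0).mul_left (Real.exp (Real.pi * S))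
  refine this.congr fun j => ?_
  simp only [uu, pow_zero, one_mul, Int.cast_abs]

lemma uu_summable' (S : ℝ) {T : ℝ} (M : ℝ) (hT : 0 < T) :
    Summable (fun j : ℤ => (2 * Real.pi * ((|j| : ℤ) + 1)) * uu S T M j) := by
  have h1 := (summable_pow_mul_jacobiTheta₂_term_bound (S + M) hT 1).mul_left
    (2 * Real.pi * Real.exp (Real.pi * S))
  have h2 := (uu_summable S M hT).mul_left (2 * Real.pi)
  refine (h1.add h2).congr fun j => ?_
  simp only [uu, pow_one, Int.cast_abs]
  ring

lemma FF_bound {S T M : ℝ} (hT : 0 < T) {z τ : ℂ} (hz : |z.im| ≤ S) (h1 : T ≤ τ.im)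
    (h2 : τ.im ≤ M) (j : ℤ) : ‖FF j z τ‖ ≤ uu S T M j := by
  have hz' := abs_le.1 hz
  rw [FF_eq, norm_mul, uu]
  have hi : |(z - τ / 2).im| ≤ S + M := by
    have : (z - τ / 2).im = z.im - τ.im / 2 := by
      rw [sub_im, show τ / 2 = τ / ((2 : ℝ) : ℂ) by norm_num, Complex.div_ofReal_im]
    rw [this, abs_le]
    constructor <;> linarith
  refine mul_le_mul ?_ (norm_jacobiTheta₂_term_le hT hi h1 j) (norm_nonneg _) (Real.exp_nonneg _)
  rw [Complex.norm_exp, Real.exp_le_exp]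
  have : (cπ * I * τ / 4 - cπ * I * z).re = Real.pi * (-(τ.im) / 4 + z.im) := by
    rw [cpi_eq, show (Real.pi : ℂ) * I * τ / 4 - Real.pi * I * z =
      (Real.pi : ℂ) * (((-1/4 : ℝ) : ℂ) * τ + z) * (-I) by push_cast; ring]
    simp [-neg_mul]
    ring
  rw [this]
  exact mul_le_mul_of_nonneg_left (by linarith) Real.pi_pos.le

lemma fac_bound (j : ℤ) : ‖2 * cπ * I * ((j : ℂ) - 1 / 2)‖ ≤ 2 * Real.pi * ((|j| : ℤ) + 1) := by
  have : ‖(j : ℂ) - 1 / 2‖ ≤ (|j| : ℤ) + 1 := by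
    refine (norm_sub_le _ _).trans ?_
    rw [Complex.norm_intCast, Int.cast_abs]
    norm_num
  rw [norm_mul, cpi_eq]
  simp only [norm_mul, Complex.norm_two, norm_I, Complex.norm_of_nonneg Real.pi_pos.le, mul_one]
  exact mul_le_mul_of_nonneg_left this (by positivity)

lemma hasDerivAt_tsum_aux {ι : Type} {F F' : ι → ℂ → ℂ} {u : ι → ℝ} {U : Set ℂ} (hU : IsOpen U)
    (hu : Summable u) (hF : ∀ i, ∀ w ∈ U, HasDerivAt (F i) (F' i w) w)
    (hb : ∀ i, ∀ w ∈ U, ‖F i w‖ ≤ u i) {z : ℂ} (hz : z ∈ U) :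
    HasDerivAt (fun w => ∑' i, F i w) (∑' i, F' i z) z := by
  have hd : ∀ i, DifferentiableOn ℂ (F i) U :=
    fun i w hw => (hF i w hw).differentiableAt.differentiableWithinAt
  have h1 := Complex.hasSum_deriv_of_summable_norm hu hd hU hb hz
  have h2 := ((Complex.differentiableOn_tsum_of_summable_norm hu hd hU hb).differentiableAt
    (hU.mem_nhds hz)).hasDerivAt
  rw [← h1.tsum_eq] at h2
  simpa only [(hF _ z hz).deriv] using h2

lemma FF_hasDerivAt_z (j : ℤ) (z τ : ℂ) :
    HasDerivAt (fun w => FF j w τ) ((2 * cπ * I * ((j : ℂ) - 1 / 2)) * FF j z τ) z := by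
  unfold FF
  have := (((hasDerivAt_id z).const_mul (2 * cπ * I * ((j : ℂ) - 1 / 2))).const_add
    (cπ * I * τ * ((j : ℂ) - 1 / 2) ^ 2)).cexp
  simp only [id, mul_one] at this
  exact this.congr_deriv (by ring)

lemma FF_hasDerivAt_t (j : ℤ) (z τ : ℂ) :
    HasDerivAt (fun t => FF j z t) ((2 * cπ * I * ((j : ℂ) - 1 / 2)) ^ 2 * FF j z τ /
      (4 * cπ * I)) τ := by
  unfold FF
  have := ((((hasDerivAt_id τ).const_mul (cπ * I)).mul_const (((j : ℂ) - 1 / 2) ^ 2)).add_const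
    (2 * cπ * I * ((j : ℂ) - 1 / 2) * z)).cexp
  simp only [id, mul_one] at this
  refine this.congr_deriv ?_
  have h : cπ ≠ 0 := by rw [cpi_eq]; exact_mod_cast Real.pi_ne_zero
  have h4 : 4 * cπ * I ≠ 0 := by simp [h]
  rw [eq_div_iff h4]
  ring

lemma isOpen_strip (S : ℝ) : IsOpen {z : ℂ | |z.im| < S} :=
  isOpen_lt (by fun_prop) (by fun_prop)

lemma isOpen_strip' (S M : ℝ) : IsOpen {z : ℂ | S < z.im ∧ z.im < M} :=
  (isOpen_lt continuous_const Complex.continuous_im).inter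
    (isOpen_lt Complex.continuous_im continuous_const)

lemma T0_z (z : ℂ) {τ : ℂ} (hτ : 0 < τ.im) : HasDerivAt (fun w => T0 w τ) (T1 z τ) z :=
  hasDerivAt_tsum_aux (isOpen_strip (|z.im| + 1)) (uu_summable (|z.im| + 1) τ.im hτ)
    (fun i w _ => FF_hasDerivAt_z i w τ)
    (fun i _ hw => FF_bound hτ (le_of_lt hw) le_rfl le_rfl i) (by simp)

lemma T1_z (z : ℂ) {τ : ℂ} (hτ : 0 < τ.im) : HasDerivAt (fun w => T1 w τ) (T2 z τ) z := by
  refine hasDerivAt_tsum_aux (ι := ℤ) (F' := fun j z => (2 * cπ * I * ((j : ℂ) - 1 / 2)) ^ 2 * FF j z τ)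
    (isOpen_strip (|z.im| + 1)) (uu_summable' (|z.im| + 1) τ.im hτ)
    (fun i w _ => ?_) (fun i w hw => ?_) (z := z) (by simp)
  · have := (FF_hasDerivAt_z i w τ).const_mul (2 * cπ * I * ((i : ℂ) - 1 / 2))
    exact this.congr_deriv (by ring)
  · rw [norm_mul]
    exact mul_le_mul (fac_bound i) (FF_bound hτ (le_of_lt hw) le_rfl le_rfl i) (norm_nonneg _)
      ((norm_nonneg _).trans (fac_bound i))

lemma T0_t (z : ℂ) {τ : ℂ} (hτ : 0 < τ.im) :
    HasDerivAt (fun t => T0 z t) (T2 z τ / (4 * cπ * I)) τ := by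
  rw [T2, ← tsum_div_const]
  refine hasDerivAt_tsum_aux
    (ι := ℤ) (F' := fun j t => (2 * cπ * I * ((j : ℂ) - 1 / 2)) ^ 2 * FF j z t / (4 * cπ * I))
    (isOpen_strip' (τ.im / 2) (τ.im + 1)) (uu_summable (|z.im|) (τ.im + 1) (half_pos hτ))
    (fun i w _ => FF_hasDerivAt_t i z w)
    (fun i w hw => FF_bound (half_pos hτ) le_rfl (le_of_lt hw.1) (le_of_lt hw.2) i) ?_
  constructor <;> linarith

lemma FF_summable (z : ℂ) {τ : ℂ} (hτ : 0 < τ.im) : Summable fun j => ‖FF j z τ‖ :=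
  Summable.of_nonneg_of_le (fun _ => norm_nonneg _)
    (fun j => FF_bound hτ le_rfl le_rfl le_rfl j) (uu_summable (|z.im|) τ.im hτ)

lemma int_even_odd {f : ℤ → ℂ} {m m' : ℂ} (he : HasSum (fun k => f (2 * k)) m)
    (ho : HasSum (fun k => f (2 * k + 1)) m') : HasSum f (m + m') := by
  have := mul_right_injective₀ (two_ne_zero' ℤ)
  replace ho := ((add_left_injective 1).comp this).hasSum_range_iff.2 ho
  refine (this.hasSum_range_iff.2 he).add_isCompl ?_ ho
  simpa [Function.comp_def] using Int.isCompl_even_odd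

lemma ThetaS_eq (z : ℂ) {τ : ℂ} (hτ : 0 < τ.im) : ThetaS 2 1 z τ = T0 z τ := by
  have hs := (FF_summable z hτ).of_norm
  have he : Summable fun k : ℤ => FF (2 * k) z τ :=
    hs.comp_injective (mul_right_injective₀ (two_ne_zero' ℤ))
  have ho : Summable fun k : ℤ => FF (2 * k + 1) z τ :=
    hs.comp_injective ((add_left_injective 1).comp (mul_right_injective₀ (two_ne_zero' ℤ)))
  have h1 : ThetaKN 2 1 z τ = ∑' k : ℤ, FF (2 * k + 1) z τ := by
    refine tsum_congr fun j => ?_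
    unfold FF
    refine congrArg exp ?_
    push_cast
    ring
  have h2 : ThetaKN 2 1 (-z) τ = ∑' k : ℤ, FF (2 * k) z τ := by
    rw [← (Equiv.neg ℤ).tsum_eq (fun k : ℤ => FF (2 * k) z τ)]
    refine tsum_congr fun j => ?_
    unfold FF
    refine congrArg exp ?_
    simp only [Equiv.neg_apply]
    push_cast
    ring
  have h3 := (int_even_odd (f := fun j => FF j z τ) he.hasSum ho.hasSum).tsum_eq
  rw [ThetaS, h1, h2, add_comm]
  exact h3.symm

lemma norm_q {τ : ℂ} (hτ : 0 < τ.im) : ‖exp (2 * cπ * I * τ)‖ < 1 := by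
  have := UpperHalfPlane.norm_exp_two_pi_I_lt_one ⟨τ, hτ⟩
  simpa [cpi_eq] using this

lemma T0_prod (z : ℂ) {τ : ℂ} (hτ : 0 < τ.im) : T0 z τ =
    exp (cπ * I * τ / 4 - cπ * I * z) * ((1 + exp (2 * cπ * I * z)) *
    ∏' n : ℕ, ((1 + exp (2 * cπ * I * τ) ^ (n + 1) * exp (2 * cπ * I * z)) *
      (1 + exp (2 * cπ * I * τ) ^ (n + 1) * exp (-(2 * cπ * I * z))) *
      (1 - exp (2 * cπ * I * τ) ^ (n + 1)))) := by
  have e : ∀ j, FF j z τ = exp (cπ * I * τ / 4 - cπ * I * z) *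
      tt (2 * cπ * I * z) (2 * cπ * I * τ) j := by
    intro j
    rw [FF, tt, ← exp_add]; congr 1; ring
  have hs := FF_summable z hτ
  simp only [e, norm_mul] at hs
  rw [summable_mul_left_iff (norm_ne_zero_iff.2 (exp_ne_zero _))] at hs
  rw [← triple_product _ _ (norm_q hτ) hs, ← tsum_mul_left, T0]
  exact tsum_congr e

lemma JTheta1_eq (z : ℂ) {τ : ℂ} (hτ : 0 < τ.im) : JTheta1 z τ = -T0 (z + 1 / 2) τ := by
  have e1 : exp (2 * cπ * I * (z + 1 / 2)) = -exp (2 * cπ * I * z) := by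
    rw [show 2 * cπ * I * (z + 1 / 2) = 2 * cπ * I * z + Real.pi * I by rw [cpi_eq]; ring,
      exp_add, exp_pi_mul_I]; ring
  have e2 : exp (-(2 * cπ * I * (z + 1 / 2))) = -exp (-(2 * cπ * I * z)) := by
    rw [exp_neg, e1, exp_neg, inv_neg]
  have e3 : exp (cπ * I * τ / 4 - cπ * I * (z + 1 / 2)) =
      exp (cπ * I * τ / 4) * exp (-(cπ * z) * I) * (-I) := by
    rw [show cπ * I * τ / 4 - cπ * I * (z + 1 / 2) =
      cπ * I * τ / 4 + -(cπ * z) * I + -(Real.pi / 2 * I) by rw [cpi_eq]; ring,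
      exp_add, exp_add, exp_neg (_ / 2 * I), exp_pi_div_two_mul_I, inv_I]
  have e4 : exp (2 * cπ * I * z) = exp (cπ * z * I) * exp (cπ * z * I) := by
    rw [← exp_add]; congr 1; ring
  have e5 : exp (-(cπ * z) * I) * exp (cπ * z * I) = 1 := by
    rw [← exp_add, ← exp_zero]; congr 1; ring
  rw [T0_prod _ hτ, e1, e2, e3, JTheta1, Complex.sin]
  simp only [mul_neg, ← sub_eq_add_neg]
  rw [e4]
  linear_combination (exp (cπ * I * τ / 4) * I * exp (cπ * z * I) * ∏' n : ℕ, ((1 - exp (2 * cπ * I * τ) ^ (n + 1) * (exp (cπ * z * I) * exp (cπ * z * I))) *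
      (1 - exp (2 * cπ * I * τ) ^ (n + 1) * exp (-(2 * cπ * I * z))) *
      (1 - exp (2 * cπ * I * τ) ^ (n + 1)))) * e5

lemma T0_prod' (z : ℂ) {τ : ℂ} (hτ : 0 < τ.im) : T0 z τ =
    2 * exp (cπ * I * τ / 4) * cos (cπ * z) *
    ∏' n : ℕ, ((1 + exp (2 * cπ * I * τ) ^ (n + 1) * exp (2 * cπ * I * z)) *
      (1 + exp (2 * cπ * I * τ) ^ (n + 1) * exp (-(2 * cπ * I * z))) *
      (1 - exp (2 * cπ * I * τ) ^ (n + 1))) := by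
  have e3 : exp (cπ * I * τ / 4 - cπ * I * z) =
      exp (cπ * I * τ / 4) * exp (-(cπ * z) * I) := by
    rw [← exp_add]; congr 1; ring
  have e4 : exp (2 * cπ * I * z) = exp (cπ * z * I) * exp (cπ * z * I) := by
    rw [← exp_add]; congr 1; ring
  have e5 : exp (-(cπ * z) * I) * exp (cπ * z * I) = 1 := by
    rw [← exp_add, ← exp_zero]; congr 1; ring
  rw [T0_prod _ hτ, e3, Complex.cos]
  rw [e4]
  linear_combination (exp (cπ * I * τ / 4) * exp (cπ * z * I) * ∏' n : ℕ, ((1 + exp (2 * cπ * I * τ) ^ (n + 1) * (exp (cπ * z * I) * exp (cπ * z * I))) *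
      (1 + exp (2 * cπ * I * τ) ^ (n + 1) * exp (-(2 * cπ * I * z))) *
      (1 - exp (2 * cπ * I * τ) ^ (n + 1)))) * e5

/-- The logarithm of the product `∏ (1+q^k)/(1-q^k)`. -/
noncomputable def LL (τ : ℂ) : ℂ := ∑' k : ℕ, (Complex.log (1 + exp (2 * cπ * I * τ) ^ (k + 1)) -
      Complex.log (1 - exp (2 * cπ * I * τ) ^ (k + 1)))

lemma norm_pow_lt {q : ℂ} (hq : ‖q‖ < 1) (n : ℕ) : ‖q ^ (n + 1)‖ < 1 := by
  rw [norm_pow]; exact pow_lt_one₀ (norm_nonneg q) hq (Nat.succ_ne_zero n)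

lemma one_add_ne {q : ℂ} (hq : ‖q‖ < 1) (n : ℕ) : 1 + q ^ (n + 1) ≠ 0 :=
  Complex.slitPlane_ne_zero (Complex.mem_slitPlane_of_norm_lt_one (norm_pow_lt hq n))

lemma log_bound {r : ℝ} (hr : r < 1) {w : ℂ} (hw : ‖w‖ ≤ r) :
    ‖Complex.log (1 + w)‖ ≤ ‖w‖ * ((1 - r)⁻¹ + 1) := by
  refine (Complex.norm_log_one_add_le (hw.trans_lt hr)).trans ?_
  have h1 : (1 - ‖w‖)⁻¹ ≤ (1 - r)⁻¹ := inv_anti₀ (by linarith) (by linarith)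
  have h0 : 0 ≤ (1 - ‖w‖)⁻¹ := inv_nonneg.2 (by linarith)
  have h2 : ‖w‖ ^ 2 * (1 - ‖w‖)⁻¹ ≤ ‖w‖ * (1 - r)⁻¹ :=
    mul_le_mul (by nlinarith [norm_nonneg w]) h1 h0 (norm_nonneg _)
  nlinarith [mul_nonneg (sq_nonneg ‖w‖) h0]

lemma norm_q_eq (τ : ℂ) : ‖exp (2 * cπ * I * τ)‖ = Real.exp (-(2 * Real.pi * τ.im)) := by
  rw [Complex.norm_exp, cpi_eq]
  congr 1
  rw [show 2 * (Real.pi : ℂ) * I * τ = ((2 * Real.pi : ℝ) : ℂ) * (τ * I) by push_cast; ring,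
    re_ofReal_mul, mul_I_re]
  ring

lemma LL_diff {τ : ℂ} (hτ : 0 < τ.im) : DifferentiableAt ℂ LL τ := by
  set r := Real.exp (-(2 * Real.pi * (τ.im / 2))) with hr
  have hr1 : r < 1 := by
    rw [hr, Real.exp_lt_one_iff]
    have := mul_pos Real.pi_pos hτ
    linarith
  have hr0 : 0 ≤ r := Real.exp_nonneg _
  have hq : ∀ t ∈ {t : ℂ | τ.im / 2 < t.im}, ‖exp (2 * cπ * I * t)‖ ≤ r := by
    intro t ht
    rw [norm_q_eq, hr, Real.exp_le_exp]
    have : τ.im / 2 < t.im := ht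
    nlinarith [Real.pi_pos]
  have hp : ∀ n : ℕ, ∀ t ∈ {t : ℂ | τ.im / 2 < t.im},
      ‖exp (2 * cπ * I * t) ^ (n + 1)‖ ≤ r ^ (n + 1) := fun n t ht => by
    rw [norm_pow]; exact pow_le_pow_left₀ (norm_nonneg _) (hq t ht) _
  have hrn : ∀ n : ℕ, r ^ (n + 1) ≤ r := fun n => pow_le_of_le_one hr0 hr1.le (Nat.succ_ne_zero n)
  have hopen : IsOpen {t : ℂ | τ.im / 2 < t.im} := isOpen_lt (by fun_prop) (by fun_prop)
  have hu : Summable fun n : ℕ => r ^ (n + 1) * ((1 - r)⁻¹ + 1) + r ^ (n + 1) * ((1 - r)⁻¹ + 1) := by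
    have := ((summable_nat_add_iff 1).mpr (summable_geometric_of_lt_one hr0 hr1)).mul_right
      ((1 - r)⁻¹ + 1)
    exact this.add this
  have hC : 0 ≤ (1 - r)⁻¹ + 1 := by
    have : 0 ≤ (1 - r)⁻¹ := inv_nonneg.2 (by linarith)
    linarith
  refine (Complex.differentiableOn_tsum_of_summable_norm hu ?_ hopen ?_).differentiableAt
    (hopen.mem_nhds (show τ.im / 2 < τ.im by linarith))
  · intro n t ht
    have h1 := ((hp n t ht).trans (hrn n)).trans_lt hr1
    refine DifferentiableAt.differentiableWithinAt ?_
    refine DifferentiableAt.sub ?_ ?_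
    · exact DifferentiableAt.clog (by fun_prop) (Complex.mem_slitPlane_of_norm_lt_one h1)
    · refine DifferentiableAt.clog (by fun_prop) ?_
      rw [sub_eq_add_neg]
      exact Complex.mem_slitPlane_of_norm_lt_one (by rwa [norm_neg])
  · intro n t ht
    have h1 := hp n t ht
    refine (norm_sub_le _ _).trans (add_le_add ?_ ?_)
    · exact (log_bound hr1 (h1.trans (hrn n))).trans (mul_le_mul_of_nonneg_right h1 hC)
    · rw [sub_eq_add_neg]
      refine (log_bound hr1 (by rw [norm_neg]; exact h1.trans (hrn n))).trans ?_
      rw [norm_neg]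
      exact mul_le_mul_of_nonneg_right h1 hC

lemma hasProd_LL {τ : ℂ} (hτ : 0 < τ.im) : HasProd (fun n : ℕ =>
    (1 - exp (2 * cπ * I * τ) ^ (n + 1)) / (1 + exp (2 * cπ * I * τ) ^ (n + 1)))
    (exp (-LL τ)) := by
  have hq := norm_q hτ
  set q := exp (2 * cπ * I * τ) with hqd
  have s1 : Summable fun k : ℕ => Complex.log (1 + q ^ (k + 1)) :=
    Complex.summable_log_one_add_of_summable (summ_pow hq).of_norm
  have s2 : Summable fun k : ℕ => Complex.log (1 - q ^ (k + 1)) := by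
    simp only [sub_eq_add_neg]
    exact Complex.summable_log_one_add_of_summable (summ_pow hq).of_norm.neg
  have := (s1.sub s2).hasSum.neg.cexp
  rw [LL, ← hqd]
  convert this using 2 with n
  simp only [Function.comp_apply, neg_sub]
  rw [exp_sub, exp_log (one_add_ne hq n), exp_log (qf_ne_zero hq n)]

lemma theta_mul (z : ℂ) {τ : ℂ} (hτ : 0 < τ.im) :
    JTheta1 z τ * T0 z τ = JTheta1 (2 * z) (2 * τ) * exp (-LL τ) := by
  have hq := norm_q hτ
  have eq2 : exp (2 * cπ * I * (2 * τ)) = exp (2 * cπ * I * τ) ^ 2 := by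
    rw [← exp_nat_mul]; congr 1; push_cast; ring
  have ex2 : exp (2 * cπ * I * (2 * z)) = exp (2 * cπ * I * z) ^ 2 := by
    rw [← exp_nat_mul]; congr 1; push_cast; ring
  have ey2 : exp (-(2 * cπ * I * (2 * z))) = exp (-(2 * cπ * I * z)) ^ 2 := by
    rw [← exp_nat_mul]; congr 1; push_cast; ring
  have ep : exp (cπ * I * (2 * τ) / 4) = exp (cπ * I * τ / 4) ^ 2 := by
    rw [← exp_nat_mul]; congr 1; push_cast; ring
  have es : sin (cπ * (2 * z)) = 2 * sin (cπ * z) * cos (cπ * z) := by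
    rw [← sin_two_mul]; congr 1; ring
  rw [T0_prod' z hτ, JTheta1, JTheta1, eq2, ex2, ey2, ep, es, ← (hasProd_LL hτ).tprod_eq]
  set q := exp (2 * cπ * I * τ)
  set x := exp (2 * cπ * I * z)
  set y := exp (-(2 * cπ * I * z))
  have mul1 : ∀ (q : ℂ), ‖q‖ < 1 → ∀ w : ℂ, Multipliable fun n : ℕ => 1 + q ^ (n + 1) * w := by
    intro q hq w
    apply multipliable_one_add_of_summable
    simpa only [norm_mul] using (summ_pow hq).mul_right ‖w‖
  have mul2 : ∀ (q : ℂ), ‖q‖ < 1 → ∀ w : ℂ, Multipliable fun n : ℕ => 1 - q ^ (n + 1) * w := by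
    intro q hq w
    simpa [sub_eq_add_neg] using mul1 q hq (-w)
  have mul3 := fun (q : ℂ) (hq : ‖q‖ < 1) => ModularForm.multipliable_one_sub_pow hq
  have hq2 : ‖q ^ 2‖ < 1 := norm_pow_lt hq 1
  have key := Multipliable.tprod_mul (((mul2 q hq x).mul (mul2 q hq y)).mul (mul3 q hq))
    (((mul1 q hq x).mul (mul1 q hq y)).mul (mul3 q hq))
  have key2 := Multipliable.tprod_mul
    (((mul2 _ hq2 (x ^ 2)).mul (mul2 _ hq2 (y ^ 2))).mul (mul3 _ hq2)) (hasProd_LL hτ).multipliable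
  have key3 : (∏' n : ℕ, ((1 - q ^ (n + 1) * x) * (1 - q ^ (n + 1) * y) * (1 - q ^ (n + 1)) *
      ((1 + q ^ (n + 1) * x) * (1 + q ^ (n + 1) * y) * (1 - q ^ (n + 1))))) =
      ∏' n : ℕ, ((1 - (q ^ 2) ^ (n + 1) * x ^ 2) * (1 - (q ^ 2) ^ (n + 1) * y ^ 2) *
        (1 - (q ^ 2) ^ (n + 1)) * ((1 - q ^ (n + 1)) / (1 + q ^ (n + 1)))) := by
    refine tprod_congr fun n => ?_
    have := one_add_ne hq n
    rw [← pow_mul, mul_comm 2, pow_mul]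
    field_simp
    ring
  rw [key, key2] at key3
  linear_combination (4 * exp (cπ * I * τ / 4) ^ 2 * sin (cπ * z) * cos (cπ * z)) * key3

end KZBaux

namespace KZBaux

/-- first and second `z`-derivatives of `JTheta1`, expressed through `T1`, `T2` -/
lemma J_z (z : ℂ) {τ : ℂ} (hτ : 0 < τ.im) :
    HasDerivAt (fun w => JTheta1 w τ) (-T1 (z + 1 / 2) τ) z := by
  have h : (fun w => JTheta1 w τ) = fun w => -T0 (w + 1 / 2) τ :=
    funext fun w => JTheta1_eq w hτ
  rw [h]
  exact ((T0_z (z + 1 / 2) hτ).comp_add_const z (1 / 2)).neg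

lemma J1_z (z : ℂ) {τ : ℂ} (hτ : 0 < τ.im) :
    HasDerivAt (fun w => -T1 (w + 1 / 2) τ) (-T2 (z + 1 / 2) τ) z :=
  ((T1_z (z + 1 / 2) hτ).comp_add_const z (1 / 2)).neg

lemma upper_nhds {τ : ℂ} (hτ : 0 < τ.im) : ∀ᶠ t in nhds τ, 0 < t.im :=
  (isOpen_lt continuous_const Complex.continuous_im).mem_nhds hτ

lemma J_t (z : ℂ) {τ : ℂ} (hτ : 0 < τ.im) :
    HasDerivAt (fun t => JTheta1 z t) (-T2 (z + 1 / 2) τ / (4 * cπ * I)) τ := by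
  have h := (T0_t (z + 1 / 2) hτ).neg
  refine (h.congr_of_eventuallyEq ?_).congr_deriv (by ring)
  filter_upwards [upper_nhds hτ] with t ht
  exact JTheta1_eq z ht

lemma S_t (z : ℂ) {τ : ℂ} (hτ : 0 < τ.im) :
    HasDerivAt (fun t => ThetaS 2 1 z t) (T2 z τ / (4 * cπ * I)) τ := by
  refine (T0_t z hτ).congr_of_eventuallyEq ?_
  filter_upwards [upper_nhds hτ] with t ht
  exact ThetaS_eq z ht

lemma cpi_ne : 4 * cπ * I ≠ 0 := by
  have h : cπ ≠ 0 := by rw [cpi_eq]; exact_mod_cast Real.pi_ne_zero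
  simp [h]

/-- The bilinear identity. -/
lemma bilinear (z : ℂ) {τ : ℂ} (hτ : 0 < τ.im) :
    -T2 (z + 1 / 2) τ * T0 z τ + JTheta1 z τ * T2 z τ - 2 * (-T1 (z + 1 / 2) τ * T1 z τ) =
      -(8 * cπ * I * (JTheta1 z τ * T0 z τ) * deriv LL τ) := by
  have hτ2 : 0 < (2 * τ).im := by simpa using hτ
  have hm : (fun w => JTheta1 w τ * T0 w τ) = fun w => JTheta1 (2 * w) (2 * τ) * exp (-LL τ) :=
    funext fun w => theta_mul w hτ
  have d1 : ∀ w, HasDerivAt (fun w => JTheta1 w τ * T0 w τ)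
      (-T1 (w + 1 / 2) τ * T0 w τ + JTheta1 w τ * T1 w τ) w := fun w => (J_z w hτ).mul (T0_z w hτ)
  have d2 : ∀ w, HasDerivAt (fun w => JTheta1 (2 * w) (2 * τ) * exp (-LL τ))
      (2 * -T1 (2 * w + 1 / 2) (2 * τ) * exp (-LL τ)) w := fun w => by
    have := (HasDerivAt.comp w (J_z (2 * w) hτ2) ((hasDerivAt_id w).const_mul 2)).mul_const
      (exp (-LL τ))
    exact this.congr_deriv (by ring)
  have e1 : (fun w => -T1 (w + 1 / 2) τ * T0 w τ + JTheta1 w τ * T1 w τ) =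
      fun w => 2 * -T1 (2 * w + 1 / 2) (2 * τ) * exp (-LL τ) := by
    funext w
    have := d1 w
    rw [hm] at this
    exact this.unique (d2 w)
  have dd1 : HasDerivAt (fun w => -T1 (w + 1 / 2) τ * T0 w τ + JTheta1 w τ * T1 w τ)
      ((-T2 (z + 1 / 2) τ * T0 z τ + -T1 (z + 1 / 2) τ * T1 z τ) +
        (-T1 (z + 1 / 2) τ * T1 z τ + JTheta1 z τ * T2 z τ)) z :=
    ((J1_z z hτ).mul (T0_z z hτ)).add ((J_z z hτ).mul (T1_z z hτ))
  have dd2 : HasDerivAt (fun w => 2 * -T1 (2 * w + 1 / 2) (2 * τ) * exp (-LL τ))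
      (4 * -T2 (2 * z + 1 / 2) (2 * τ) * exp (-LL τ)) z := by
    have := ((HasDerivAt.comp z (J1_z (2 * z) hτ2) ((hasDerivAt_id z).const_mul 2)).const_mul
      2).mul_const (exp (-LL τ))
    exact this.congr_deriv (by ring)
  rw [e1] at dd1
  have E2 := dd1.unique dd2
  have t1 := (J_t z hτ).mul (T0_t z hτ)
  have t2 := (HasDerivAt.comp τ (J_t (2 * z) hτ2) ((hasDerivAt_id τ).const_mul 2)).mul
    (LL_diff hτ).hasDerivAt.neg.cexp
  have hev : (fun t => JTheta1 z t * T0 z t) =ᶠ[nhds τ]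
      fun t => JTheta1 (2 * z) (2 * t) * exp (-LL t) := by
    filter_upwards [upper_nhds hτ] with t ht
    exact theta_mul z ht
  have E3 := t1.unique (t2.congr_of_eventuallyEq hev)
  simp only [Function.comp_apply, mul_one] at E3
  have E4 := congrArg (fun x => 4 * cπ * I * x) E3
  have c0 := cpi_ne
  have s1 : ∀ a : ℂ, a / (4 * cπ * I) * (4 * cπ * I) = a := fun a => div_mul_cancel₀ a c0
  have E0 := theta_mul z hτ
  have g1 := s1 (-T2 (z + 1 / 2) τ)
  have g2 := s1 (T2 z τ)
  have g3 := s1 (-T2 (2 * z + 1 / 2) (2 * τ))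
  simp only [Pi.neg_apply] at E4
  linear_combination 2 * E4 - E2 - 2 * T0 z τ * g1 - 2 * JTheta1 z τ * g2 +
    4 * exp (-LL τ) * g3 + 8 * cπ * I * deriv LL τ * E0

end KZBaux

open KZBaux

/-- For `κ = 2p+4`, the function
`v(λ,τ) = (φ₃(τ)/η(τ))^{4(p+1)/κ} ϑ₁(λ,τ)^{p+1} θ^s_{2,1}(λ,τ)` (with the above branch
of the power) satisfies the KZB heat equation with parameters `κ`, `p` at every
`(λ,τ) ∈ ℂ×ℍ` with `ϑ₁(λ,τ) ≠ 0`. -/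
theorem KZB_kappa_2p4 (p : ℕ) :
    ∀ z τ : ℂ, 0 < τ.im → JTheta1 z τ ≠ 0 →
      KZB (2 * p + 4) p (fun w t =>
        GPow (4 * ((p : ℝ) + 1) / (2 * (p : ℝ) + 4)) t *
          JTheta1 w t ^ (p + 1) * ThetaS 2 1 w t) z τ := by
  intro z τ hτ hJ
  set c : ℝ := 4 * ((p : ℝ) + 1) / (2 * (p : ℝ) + 4) with hc
  have hcc : (c : ℂ) * (2 * p + 4) = 4 * (p + 1) := by
    have h : (2 * (p : ℝ) + 4) ≠ 0 := by positivity
    have : c * (2 * p + 4) = 4 * (p + 1) := by rw [hc]; field_simp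
    exact_mod_cast this
  have hG : HasDerivAt (GPow c) (GPow c τ * (c * deriv LL τ)) τ := by
    have h := ((((LL_diff hτ).hasDerivAt).const_add ((Real.log 2 : ℂ) / 2)).const_mul (c : ℂ)).cexp
    exact h
  have ht := (hG.mul ((J_t z hτ).pow (p + 1))).mul (S_t z hτ)
  have ht' := ht.deriv
  set g := GPow c τ with hg
  have hS : (fun w => ThetaS 2 1 w τ) = fun w => T0 w τ := funext fun w => ThetaS_eq w hτ
  have hz1 : ∀ w, HasDerivAt (fun w => g * JTheta1 w τ ^ (p + 1) * ThetaS 2 1 w τ)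
      (g * ((p + 1) * JTheta1 w τ ^ p * -T1 (w + 1 / 2) τ) * T0 w τ +
        g * JTheta1 w τ ^ (p + 1) * T1 w τ) w := by
    intro w
    have h := (((J_z w hτ).pow (p + 1)).const_mul g).mul (T0_z w hτ)
    have e : (fun w => g * JTheta1 w τ ^ (p + 1) * ThetaS 2 1 w τ) =
        fun w => g * JTheta1 w τ ^ (p + 1) * T0 w τ := by
      funext w; rw [ThetaS_eq w hτ]
    rw [e]
    refine h.congr_deriv ?_
    simp
  have hd1 : deriv (fun w => g * JTheta1 w τ ^ (p + 1) * ThetaS 2 1 w τ) = fun w =>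
      (g * ((p + 1) * JTheta1 w τ ^ p * -T1 (w + 1 / 2) τ) * T0 w τ +
        g * JTheta1 w τ ^ (p + 1) * T1 w τ) := funext fun w => (hz1 w).deriv
  have hz2 := ((((((J_z z hτ).pow p).const_mul ((p : ℂ) + 1)).mul (J1_z z hτ)).const_mul g).mul
    (T0_z z hτ)).add ((((J_z z hτ).pow (p + 1)).const_mul g).mul (T1_z z hτ))
  have hz2' := hz2.deriv
  have hR : Rho' z τ = (-T2 (z + 1 / 2) τ * JTheta1 z τ - T1 (z + 1 / 2) τ ^ 2) /
      JTheta1 z τ ^ 2 := by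
    have e : (fun w => Rho w τ) = fun w => -T1 (w + 1 / 2) τ / JTheta1 w τ := by
      funext w
      rw [Rho, (J_z w hτ).deriv]
    rw [Rho', e]
    refine (((J1_z z hτ).div (J_z z hτ) hJ).deriv).trans ?_
    congr 1; ring
  have hB := bilinear z hτ
  have hS' := ThetaS_eq z hτ
  unfold KZB
  rw [iteratedDeriv_succ, iteratedDeriv_one]
  have ht'' : deriv (fun t => GPow c t * JTheta1 z t ^ (p + 1) * ThetaS 2 1 z t) τ = _ := ht'
  have hz2'' : deriv (fun w => (g * ((p + 1) * JTheta1 w τ ^ p * -T1 (w + 1 / 2) τ) * T0 w τ +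
        g * JTheta1 w τ ^ (p + 1) * T1 w τ)) z = _ := hz2'
  show 2 * cπ * I * ((2 * p + 4 : ℕ) : ℂ) *
    deriv (fun t => GPow c t * JTheta1 z t ^ (p + 1) * ThetaS 2 1 z t) τ =
    deriv (deriv (fun w => g * JTheta1 w τ ^ (p + 1) * ThetaS 2 1 w τ)) z +
      (p : ℂ) * ((p : ℂ) + 1) * Rho' z τ * (g * JTheta1 z τ ^ (p + 1) * ThetaS 2 1 z τ)
  rw [ht'', hd1, hz2'', hR, hS']
  simp only [Pi.mul_apply, Pi.pow_apply, Nat.add_sub_cancel]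
  rw [← hg]
  have c0 := cpi_ne
  have g1 : -T2 (z + 1 / 2) τ / (4 * cπ * I) * (4 * cπ * I) = -T2 (z + 1 / 2) τ :=
    div_mul_cancel₀ _ c0
  have g2 : T2 z τ / (4 * cπ * I) * (4 * cπ * I) = T2 z τ := div_mul_cancel₀ _ c0
  have ha : JTheta1 z τ * (JTheta1 z τ)⁻¹ = 1 := mul_inv_cancel₀ hJ
  have hpm : (p : ℂ) * JTheta1 z τ ^ (p - 1) = p * JTheta1 z τ ^ p * (JTheta1 z τ)⁻¹ := by
    rcases Nat.eq_zero_or_pos p with h | h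
    · simp [h]
    · obtain ⟨k, rfl⟩ : ∃ k, p = k + 1 := ⟨p - 1, by omega⟩
      rw [Nat.add_sub_cancel, pow_succ]
      field_simp
  rw [div_eq_mul_inv _ (JTheta1 z τ ^ 2), ← inv_pow, pow_succ (JTheta1 z τ) p]
  push_cast
  generalize JTheta1 z τ ^ (p - 1) = Nm at *
  generalize JTheta1 z τ ^ p = N at *
  generalize (JTheta1 z τ)⁻¹ = a at *
  generalize JTheta1 z τ = J at *
  generalize -T2 (z + 1 / 2) τ / (4 * cπ * I) = U at *
  generalize T2 z τ / (4 * cπ * I) = V at *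
  generalize T2 z τ = Y at *
  generalize T2 (z + 1 / 2) τ = X at *
  generalize T1 (z + 1 / 2) τ = t at *
  generalize T1 z τ = s at *
  generalize T0 z τ = B at *
  generalize deriv LL τ = l at *
  linear_combination (2 * cπ * I * g * l * N * J * B) * hcc + (p + 1) * g * N * hB
    - (p + 1) * g * B * t ^ 2 * hpm + p * (p + 1) * g * N * B * X * (J * a + 1) * ha
    + p * (p + 1) * g * N * B * t ^ 2 * a * ha
    + (p + 2) * (p + 1) * g * N * B * g1 + (p + 2) * g * N * J * g2
end
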